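/- arXiv:1107.5191 — 2 statements merged into one kernel-verified Lean document; each statement's English description precedes it below -/
import Mathlib

section
/- If k is a P-integer, then k < 10^3500. -/
open scoped BigOperators

/-- Number of primes not exceeding the real number `x` (so `primePi x = 0` for `x ≤ 1`). -/
noncomputable def primePi (x : ℝ) : ℕ :=
  ((Finset.range (⌊x⌋₊ + 1)).filter Nat.Prime).card

/-- The `n`-th prime, with `nthPrime 1 = 2`, `nthPrime 2 = 3`, etc. -/
noncomputable def nthPrime (n : ℕ) : ℕ := Nat.nth Nat.Prime (n - 1)
/-- The `i`-th (0-indexed) prime not dividing `k`, in increasing order. -/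
noncomputable def nthPrimeNotDvd (k i : ℕ) : ℕ := Nat.nth (fun p => p.Prime ∧ ¬ p ∣ k) i

/-- `k` is a `P`-integer: `k > 1` and the first `φ(k)` primes not dividing `k` are pairwise
incongruent modulo `k` and their residues are exactly the residues coprime to `k`. -/
def IsPInteger (k : ℕ) : Prop :=
  1 < k ∧
  Set.InjOn (fun i => nthPrimeNotDvd k i % k) (Set.Iio k.totient) ∧
  (fun i => nthPrimeNotDvd k i % k) '' Set.Iio k.totient = {r | r < k ∧ Nat.Coprime r k}

theorem exists_card_filter_not_dvd_le {q : ℕ} (hq : 0 < q) (k : ℕ) (S : Finset ℕ) :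
    ∃ c : ℕ, ((S.filter fun j => ¬ q ∣ c + j * k).card : ℝ) ≤ S.card * (1 - 1 / q) := by
  have hq' : (0 : ℝ) < q := by exact_mod_cast hq
  obtain ⟨c, -, hc⟩ := Finset.exists_le_card_fiber_of_nsmul_le_card_of_maps_to
    (s := S) (t := Finset.range q) (f := fun j => (j * (k * (q - 1))) % q) (b := (S.card : ℝ) / q)
    (fun a _ => Finset.mem_range.2 (Nat.mod_lt _ hq)) ⟨0, Finset.mem_range.2 hq⟩
    (by rw [Finset.card_range, nsmul_eq_mul]; field_simp; exact le_refl _)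
  refine ⟨c, ?_⟩
  have hsub : (S.filter fun j => (j * (k * (q - 1))) % q = c) ⊆ S.filter fun j => q ∣ c + j * k := by
    intro j hj
    rw [Finset.mem_filter] at hj ⊢
    refine ⟨hj.1, ?_⟩
    rw [← hj.2, Nat.dvd_iff_mod_eq_zero, Nat.mod_add_mod]
    obtain ⟨r, rfl⟩ : ∃ r, q = r + 1 := ⟨q - 1, by omega⟩
    have : j * (k * (r + 1 - 1)) + j * k = (r + 1) * (j * k) := by
      simp only [Nat.add_sub_cancel]; ring
    rw [this, Nat.mul_mod_right]
  have h1 : ((S.filter fun j => q ∣ c + j * k).card : ℝ)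
      + (S.filter fun j => ¬ q ∣ c + j * k).card = S.card := by
    exact_mod_cast Finset.card_filter_add_card_filter_not (s := S) (fun j => q ∣ c + j * k)
  have h2 : (S.card : ℝ) / q ≤ (S.filter fun j => q ∣ c + j * k).card :=
    hc.trans (by exact_mod_cast Finset.card_le_card hsub)
  have : (S.card : ℝ) * (1 - 1 / q) = S.card - S.card / q := by ring
  linarith

/-- Greedy choice of one residue class for every modulus in `P`. -/
theorem exists_greedy_cover (k : ℕ) (S P : Finset ℕ) (hP : ∀ q ∈ P, 0 < q) :
    ∃ c : ℕ → ℕ, ((S.filter fun j => ∀ q ∈ P, ¬ q ∣ c q + j * k).card : ℝ)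
      ≤ S.card * ∏ q ∈ P, (1 - 1 / (q : ℝ)) := by
  induction P using Finset.induction_on with
  | empty => exact ⟨fun _ => 0, by simp⟩
  | insert p P hp ih =>
    obtain ⟨c, hc⟩ := ih fun q hq => hP q (Finset.mem_insert_of_mem hq)
    have hp0 : 0 < p := hP p (Finset.mem_insert_self _ _)
    obtain ⟨d, hd⟩ := exists_card_filter_not_dvd_le hp0 k
      (S.filter fun j => ∀ q ∈ P, ¬ q ∣ c q + j * k)
    refine ⟨Function.update c p d, ?_⟩
    have hset : (S.filter fun j => ∀ q ∈ insert p P, ¬ q ∣ Function.update c p d q + j * k)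
        = (S.filter fun j => ∀ q ∈ P, ¬ q ∣ c q + j * k).filter fun j => ¬ p ∣ d + j * k := by
      ext j
      simp only [Finset.mem_filter, Finset.forall_mem_insert, Function.update_self, and_assoc]
      have : (∀ q ∈ P, ¬ q ∣ Function.update c p d q + j * k) ↔ ∀ q ∈ P, ¬ q ∣ c q + j * k := by
        refine forall₂_congr fun q hq => ?_
        rw [Function.update_of_ne (by rintro rfl; exact hp hq)]
      rw [this]
      tauto
    rw [hset, Finset.prod_insert hp]
    refine hd.trans ?_
    have h1 : (1 : ℝ) / p ≤ 1 := by
      rw [div_le_one (by exact_mod_cast hp0)]; exact_mod_cast hp0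
    calc _ ≤ (S.card * ∏ q ∈ P, (1 - 1 / (q : ℝ))) * (1 - 1 / p) :=
          mul_le_mul_of_nonneg_right hc (by linarith)
      _ = _ := by ring

/-- Among `T` consecutive terms of an arithmetic progression, at most `T / r + 1` are divisible by
a prime `r` not dividing the difference. -/
theorem card_filter_dvd_add_mul_le {r m : ℕ} (hr : 0 < r) (hrm : r.Coprime m) (c Y T : ℕ) :
    ((Finset.Ioc Y (Y + T)).filter fun t => r ∣ c + m * t).card ≤ T / r + 1 := by
  by_cases h : ∃ v, r ∣ c + m * v
  · obtain ⟨v, hv⟩ := h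
    have hsub : ((Finset.Ioc Y (Y + T)).filter fun t => r ∣ c + m * t)
        ⊆ (Finset.Ioc Y (Y + T)).filter fun t => t ≡ v [MOD r] := by
      intro t ht
      rw [Finset.mem_filter] at ht ⊢
      refine ⟨ht.1, ?_⟩
      have h1 : c + m * t ≡ c + m * v [MOD r] :=
        ((Nat.modEq_zero_iff_dvd.2 ht.2).trans (Nat.modEq_zero_iff_dvd.2 hv).symm)
      exact Nat.ModEq.cancel_left_of_coprime hrm (Nat.ModEq.add_left_cancel' c h1)
    refine (Finset.card_le_card hsub).trans ?_
    have hcard := Nat.Ioc_filter_modEq_card Y (Y + T) hr v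
    have hr' : (0 : ℚ) < r := by exact_mod_cast hr
    have key : ((Finset.Ioc Y (Y + T)).filter fun t => t ≡ v [MOD r]).card ≤ (T : ℚ) / r + 1 := by
      have : ((((Finset.Ioc Y (Y + T)).filter fun t => t ≡ v [MOD r]).card : ℤ) : ℚ)
          ≤ (T : ℚ) / r + 1 := by
        rw [hcard]
        push_cast
        refine max_le ?_ (by positivity)
        have h1 := Int.floor_le (((Y : ℚ) + T - v) / r)
        have h2 := Int.lt_floor_add_one (((Y : ℚ) - v) / r)
        have h3 : ((Y : ℚ) + T - v) / r = ((Y : ℚ) - v) / r + T / r := by ring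
        linarith
      exact_mod_cast this
    have h4 : (((Finset.Ioc Y (Y + T)).filter fun t => t ≡ v [MOD r]).card - 1 : ℚ) * r ≤ T := by
      rw [← le_div_iff₀ hr']; linarith
    have h5 : ((((Finset.Ioc Y (Y + T)).filter fun t => t ≡ v [MOD r]).card : ℤ) - 1) * r ≤ T := by
      exact_mod_cast h4
    rw [← Nat.sub_le_iff_le_add, Nat.le_div_iff_mul_le hr]
    zify
    by_cases h6 : 1 ≤ ((Finset.Ioc Y (Y + T)).filter fun t => t ≡ v [MOD r]).card
    · rw [Nat.cast_sub h6]; exact_mod_cast h5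
    · have : ((Finset.Ioc Y (Y + T)).filter fun t => t ≡ v [MOD r]).card - 1 = 0 := by omega
      rw [this]; simp
  · push Not at h
    rw [Finset.filter_false_of_mem fun t _ => h t]
    simp

theorem exists_coprime_of_forall_not_prime {k z Y J T : ℕ} (hk : 1 < k) (hY : 0 < Y)
    (hQ : ((J : ℝ) + 1) * ∏ q ∈ z.primesLE.filter (fun q => ¬ q ∣ k), (1 - 1 / (q : ℝ))
      < ((Finset.Ioc z Y).filter fun q => q.Prime ∧ ¬ q ∣ k).card + 1)
    (hm : ∀ n : ℕ, (n : ℝ) ≤ ((J : ℝ) + 1) *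
      ∏ q ∈ z.primesLE.filter (fun q => ¬ q ∣ k), (1 - 1 / (q : ℝ)) →
      primorial z * Y ^ n * (Y + T + 1) ≤ k)
    (hD : ∑ r ∈ k.primeFactors.filter (z < ·), ((T : ℝ) / r + 1) < T) :
    ∃ a < k, a.Coprime k ∧ ∀ j ≤ J, ¬ (a + j * k).Prime := by
  classical
  set Ps := z.primesLE.filter (fun q => ¬ q ∣ k) with hPs
  set Q := (Finset.Ioc z Y).filter fun q => q.Prime ∧ ¬ q ∣ k with hQdef
  obtain ⟨c, hc⟩ := exists_greedy_cover k (Finset.range (J + 1)) Ps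
    (fun q hq => (Nat.mem_primesLE.1 (Finset.mem_filter.1 hq).1).2.pos)
  set R := (Finset.range (J + 1)).filter fun j => ∀ q ∈ Ps, ¬ q ∣ c q + j * k with hR
  rw [Finset.card_range] at hc
  push_cast at hc
  have hRQ : R.card ≤ Q.card := by
    have : (R.card : ℝ) < Q.card + 1 := hc.trans_lt hQ
    exact_mod_cast Nat.lt_succ_iff.1 (by exact_mod_cast this)
  obtain ⟨Q', hQ'Q, hQ'card⟩ := Finset.exists_subset_card_eq hRQ
  obtain ⟨e⟩ : Nonempty (R ≃ Q') := ⟨Finset.equivOfCardEq hQ'card.symm⟩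
  have hQ'mem : ∀ q ∈ Q', z < q ∧ q ≤ Y ∧ q.Prime ∧ ¬ q ∣ k := fun q hq => by
    have := hQ'Q hq
    simp only [hQdef, Finset.mem_filter, Finset.mem_Ioc] at this
    tauto
  -- the residue to be prescribed modulo each prime
  let res : ℕ → ℕ := fun q =>
    if hq : q ∈ Q' then (e.symm ⟨q, hq⟩ : ℕ) * (k * (q - 1)) else if q ∣ k then 1 else c q
  set U := z.primesLE ∪ Q' with hU
  have hUprime : ∀ q ∈ U, q.Prime := fun q hq => by
    rcases Finset.mem_union.1 hq with h | h
    · exact (Nat.mem_primesLE.1 h).2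
    · exact (hQ'mem q h).2.2.1
  have hs : ∀ q ∈ U, q ≠ 0 := fun q hq => (hUprime q hq).ne_zero
  have hpp : (↑U : Set ℕ).Pairwise (Function.onFun Nat.Coprime fun q : ℕ => q) :=
    fun p hp q hq hpq => (Nat.coprime_primes (hUprime p hp) (hUprime q hq)).2 hpq
  set a₀ := (Nat.chineseRemainderOfFinset res (fun q => q) U hs hpp : ℕ) with ha₀
  have ha₀mod : ∀ q ∈ U, a₀ ≡ res q [MOD q] :=
    (Nat.chineseRemainderOfFinset res (fun q => q) U hs hpp).2
  set m := ∏ q ∈ U, q with hmdef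
  have ha₀lt : a₀ < m := Nat.chineseRemainderOfFinset_lt_prod res (fun q => q) hs hpp
  have hdisj : Disjoint z.primesLE Q' := Finset.disjoint_left.2 fun q h1 h2 =>
    absurd (Nat.mem_primesLE.1 h1).1 (not_le.2 (hQ'mem q h2).1)
  have hmle : m ≤ primorial z * Y ^ R.card := by
    rw [hmdef, hU, Finset.prod_union hdisj]
    refine Nat.mul_le_mul (le_of_eq ?_) ?_
    · rw [primorial]
      exact Finset.prod_congr (by ext p; simp [Nat.mem_primesLE]) fun _ _ => rfl
    · rw [← hQ'card]
      exact Finset.prod_le_pow_card _ _ _ fun q hq => (hQ'mem q hq).2.1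
  have hmk : m * (Y + T + 1) ≤ k := (Nat.mul_le_mul_right _ hmle).trans (hm R.card hc)
  have hm0 : 0 < m := Finset.prod_pos fun q hq => (hUprime q hq).pos
  -- a term of the progression coprime to the large prime factors of `k`
  obtain ⟨t, htI, ht⟩ : ∃ t ∈ Finset.Ioc Y (Y + T),
      ∀ r ∈ k.primeFactors.filter (z < ·), ¬ r ∣ a₀ + m * t := by
    by_contra! hcon
    have hsub : Finset.Ioc Y (Y + T) ⊆ (k.primeFactors.filter (z < ·)).biUnion
        fun r => (Finset.Ioc Y (Y + T)).filter fun t => r ∣ a₀ + m * t := by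
      intro t ht
      obtain ⟨r, hr, hrt⟩ := hcon t ht
      exact Finset.mem_biUnion.2 ⟨r, hr, Finset.mem_filter.2 ⟨ht, hrt⟩⟩
    have h1 := (Finset.card_le_card hsub).trans Finset.card_biUnion_le
    rw [Nat.card_Ioc, Nat.add_sub_cancel_left] at h1
    have h2 : (T : ℝ) ≤ ∑ r ∈ k.primeFactors.filter (z < ·), ((T : ℝ) / r + 1) := by
      refine (Nat.cast_le.2 h1).trans ?_
      push_cast
      refine Finset.sum_le_sum fun r hr => ?_
      rw [Finset.mem_filter, Nat.mem_primeFactors] at hr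
      have hcop : r.Coprime m := by
        refine Nat.Coprime.prod_right fun q hq => ?_
        refine (Nat.coprime_primes hr.1.1 (hUprime q hq)).2 ?_
        rintro rfl
        rcases Finset.mem_union.1 hq with h | h
        · exact absurd (Nat.mem_primesLE.1 h).1 (not_le.2 hr.2)
        · exact (hQ'mem r h).2.2.2 hr.1.2.1
      have h3 := card_filter_dvd_add_mul_le hr.1.1.pos hcop a₀ Y T
      refine (Nat.cast_le.2 h3).trans ?_
      push_cast
      have : ((T / r : ℕ) : ℝ) ≤ (T : ℝ) / r := Nat.cast_div_le
      linarith
    exact absurd h2 (not_le.2 hD)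
  rw [Finset.mem_Ioc] at htI
  set a := a₀ + m * t with ha
  have hmodU : ∀ q ∈ U, a ≡ res q [MOD q] := fun q hq => by
    have h1 : m * t ≡ 0 [MOD q] :=
      Nat.modEq_zero_iff_dvd.2 (Dvd.dvd.mul_right (Finset.dvd_prod_of_mem _ hq) t)
    simpa using (ha₀mod q hq).add h1
  have haY : Y < a := by nlinarith
  refine ⟨a, ?_, ?_, ?_⟩
  · have : m * t ≤ m * (Y + T) := Nat.mul_le_mul_left _ htI.2
    nlinarith
  · refine Nat.Coprime.symm (Nat.coprime_of_dvd fun r hr hrk hra => ?_)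
    by_cases hrz : r ≤ z
    · have hrU : r ∈ U := Finset.mem_union_left _ (Nat.mem_primesLE.2 ⟨hrz, hr⟩)
      have hrQ : r ∉ Q' := fun h => (hQ'mem r h).2.2.2 hrk
      have h1 := hmodU r hrU
      simp only [res, hrQ, dite_false, hrk, if_true] at h1
      have h2 := (Nat.modEq_zero_iff_dvd.2 hra).symm.trans h1
      exact hr.one_lt.ne' (Nat.dvd_one.1 (Nat.modEq_zero_iff_dvd.1 h2.symm))
    · exact ht r (Finset.mem_filter.2 ⟨Nat.mem_primeFactors.2 ⟨hr, hrk, by omega⟩,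
        not_le.1 hrz⟩) hra
  · intro j hj hprime
    have key : ∀ q ∈ U, q ≤ Y ∨ q ≤ z → q ∣ a + j * k → q = a + j * k := fun q hq _ hqd =>
      (hprime.eq_one_or_self_of_dvd q hqd).resolve_left (hUprime q hq).one_lt.ne'
    by_cases hjR : j ∈ R
    · set q : ℕ := (e ⟨j, hjR⟩ : ℕ) with hq
      have hqQ : q ∈ Q' := (e ⟨j, hjR⟩).2
      have hqU : q ∈ U := Finset.mem_union_right _ hqQ
      have hres : res q = j * (k * (q - 1)) := by
        simp only [res, hqQ, dite_true]
        congr 1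
        have : (⟨q, hqQ⟩ : Q') = e ⟨j, hjR⟩ := Subtype.ext hq
        rw [this, Equiv.symm_apply_apply]
      have hd : q ∣ a + j * k := by
        rw [← Nat.modEq_zero_iff_dvd]
        refine ((hmodU q hqU).add_right (j * k)).trans ?_
        rw [hres, Nat.modEq_zero_iff_dvd]
        obtain ⟨r, hr⟩ : ∃ r, q = r + 1 := ⟨q - 1, by have := (hUprime q hqU).pos; omega⟩
        rw [hr]
        exact ⟨j * k, by simp only [Nat.add_sub_cancel]; ring⟩
      have h1 := key q hqU (Or.inl (hQ'mem q hqQ).2.1) hd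
      have h2 := (hQ'mem q hqQ).2.1
      omega
    · have : ∃ q ∈ Ps, q ∣ c q + j * k := by
        by_contra! hcon
        exact hjR (Finset.mem_filter.2 ⟨Finset.mem_range.2 (by omega), hcon⟩)
      obtain ⟨q, hqP, hqd⟩ := this
      have hqz := Nat.mem_primesLE.1 (Finset.mem_filter.1 hqP).1
      have hqk : ¬ q ∣ k := (Finset.mem_filter.1 hqP).2
      have hqU : q ∈ U := Finset.mem_union_left _ (Finset.mem_filter.1 hqP).1
      have hqQ : q ∉ Q' := fun h => absurd hqz.1 (not_le.2 (hQ'mem q h).1)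
      have hres : res q = c q := by simp only [res, hqQ, dite_false, hqk, if_false]
      have hd : q ∣ a + j * k := by
        rw [← Nat.modEq_zero_iff_dvd]
        refine ((hmodU q hqU).add_right (j * k)).trans ?_
        rw [hres, Nat.modEq_zero_iff_dvd]
        exact hqd
      have h1 := key q hqU (Or.inr hqz.1) hd
      have h2 : q ≤ m := Nat.le_of_dvd hm0 (Finset.dvd_prod_of_mem _ hqU)
      have h3 : m * 2 ≤ m * t := Nat.mul_le_mul_left _ (by omega)
      omega

theorem log_prod_primeFactors_le {k : ℕ} (hk : 0 < k) :
    ∑ r ∈ k.primeFactors, Real.log r ≤ Real.log k := by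
  rw [← Real.log_prod fun r hr => by
    exact_mod_cast (Nat.prime_of_mem_primeFactors hr).ne_zero]
  refine Real.log_le_log (Finset.prod_pos fun r hr => by
    exact_mod_cast (Nat.prime_of_mem_primeFactors hr).pos) ?_
  rw [← Nat.cast_prod]
  exact_mod_cast Nat.le_of_dvd hk (Nat.prod_primeFactors_dvd k)

theorem one_sub_one_div_prime_mem {p : ℕ} (hp : p.Prime) :
    0 < 1 - 1 / (p : ℝ) ∧ 1 - 1 / (p : ℝ) ≤ 1 := by
  have h2 : (2 : ℝ) ≤ p := by exact_mod_cast hp.two_le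
  have h : 1 / (p : ℝ) ≤ 1 / 2 := by gcongr
  have h0 : 0 < 1 / (p : ℝ) := by positivity
  constructor <;> linarith

theorem add_one_mul_prod_le {k z J : ℕ} (hk : 0 < k) {B : ℝ} (hB : 0 ≤ B)
    (hJ : (J : ℝ) ≤ B * (k.totient / k)) :
    ((J : ℝ) + 1) * ∏ q ∈ z.primesLE.filter (fun q => ¬ q ∣ k), (1 - 1 / (q : ℝ))
      ≤ B * ∏ q ∈ z.primesLE, (1 - 1 / (q : ℝ)) + 1 := by
  set f : ℕ → ℝ := fun q => 1 - 1 / (q : ℝ) with hf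
  have hle1 : ∀ s : Finset ℕ, (∀ q ∈ s, q.Prime) → 0 < ∏ q ∈ s, f q ∧ ∏ q ∈ s, f q ≤ 1 :=
    fun s hs => ⟨Finset.prod_pos fun q hq => (one_sub_one_div_prime_mem (hs q hq)).1,
      Finset.prod_le_one (fun q hq => (one_sub_one_div_prime_mem (hs q hq)).1.le)
        fun q hq => (one_sub_one_div_prime_mem (hs q hq)).2⟩
  have hz : ∀ q ∈ z.primesLE, q.Prime := fun q hq => (Nat.mem_primesLE.1 hq).2
  have hρ : (k.totient / k : ℝ) = ∏ q ∈ k.primeFactors, f q := by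
    have h := Nat.totient_eq_mul_prod_factors k
    have h' : (k.totient : ℝ) = k * ∏ p ∈ k.primeFactors, (1 - (p : ℝ)⁻¹) := by
      have := congrArg (fun x : ℚ => (x : ℝ)) h
      push_cast at this
      exact this
    rw [h', mul_div_cancel_left₀ _ (by exact_mod_cast hk.ne')]
    simp [hf]
  have hρle : (k.totient / k : ℝ) ≤ ∏ q ∈ z.primesLE.filter (fun q => q ∣ k), f q := by
    rw [hρ]
    have hsub : z.primesLE.filter (fun q => q ∣ k) ⊆ k.primeFactors := fun q hq => by
      rw [Finset.mem_filter] at hq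
      exact Nat.mem_primeFactors.2 ⟨hz q hq.1, hq.2, hk.ne'⟩
    rw [← Finset.prod_sdiff hsub]
    have h1 := hle1 (k.primeFactors \ z.primesLE.filter (fun q => q ∣ k)) fun q hq =>
      Nat.prime_of_mem_primeFactors (Finset.mem_sdiff.1 hq).1
    have h2 := hle1 (z.primesLE.filter (fun q => q ∣ k)) fun q hq =>
      hz q (Finset.mem_filter.1 hq).1
    nlinarith
  have hsplit : ∏ q ∈ z.primesLE, f q = (∏ q ∈ z.primesLE.filter (fun q => q ∣ k), f q) *
      ∏ q ∈ z.primesLE.filter (fun q => ¬ q ∣ k), f q :=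
    (Finset.prod_filter_mul_prod_filter_not _ _ _).symm
  have hP := hle1 (z.primesLE.filter (fun q => ¬ q ∣ k)) fun q hq =>
    hz q (Finset.mem_filter.1 hq).1
  rw [hsplit]
  have h3 : (J : ℝ) ≤ B * ∏ q ∈ z.primesLE.filter (fun q => q ∣ k), f q :=
    hJ.trans (mul_le_mul_of_nonneg_left hρle hB)
  nlinarith

theorem theta_sub_le_card_mul_log {k z Y : ℕ} (hk : 0 < k) (hzY : z ≤ Y) :
    Chebyshev.theta Y - Chebyshev.theta z - Real.log k ≤
      ((Finset.Ioc z Y).filter fun q => q.Prime ∧ ¬ q ∣ k).card * Real.log Y := by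
  have hunion : Y.primesLE = z.primesLE ∪ ((Finset.Ioc z Y).filter Nat.Prime) := by
    ext q
    simp only [Nat.mem_primesLE, Finset.mem_union, Finset.mem_filter, Finset.mem_Ioc]
    constructor
    · rintro ⟨h1, h2⟩
      by_cases h : q ≤ z
      · exact Or.inl ⟨h, h2⟩
      · exact Or.inr ⟨⟨by omega, h1⟩, h2⟩
    · rintro (⟨h1, h2⟩ | ⟨⟨h1, h2⟩, h3⟩)
      · exact ⟨by omega, h2⟩
      · exact ⟨h2, h3⟩
  have hdisj : Disjoint z.primesLE ((Finset.Ioc z Y).filter Nat.Prime) :=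
    Finset.disjoint_left.2 fun q h1 h2 => by
      rw [Nat.mem_primesLE] at h1
      rw [Finset.mem_filter, Finset.mem_Ioc] at h2
      omega
  rw [Chebyshev.theta_eq_sum_primesLE_log, Chebyshev.theta_eq_sum_primesLE_log, hunion,
    Finset.sum_union hdisj,
    ← Finset.sum_filter_add_sum_filter_not ((Finset.Ioc z Y).filter Nat.Prime) (fun q => q ∣ k)]
  have h1 : ∑ q ∈ ((Finset.Ioc z Y).filter Nat.Prime).filter (fun q => q ∣ k), Real.log q
      ≤ Real.log k := by
    refine le_trans (Finset.sum_le_sum_of_subset_of_nonneg ?_ fun q _ _ =>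
      Real.log_natCast_nonneg q) (log_prod_primeFactors_le hk)
    intro q hq
    simp only [Finset.mem_filter] at hq
    exact Nat.mem_primeFactors.2 ⟨hq.1.2, hq.2, hk.ne'⟩
  have h2 : ∑ q ∈ ((Finset.Ioc z Y).filter Nat.Prime).filter (fun q => ¬ q ∣ k), Real.log q
      ≤ ((Finset.Ioc z Y).filter fun q => q.Prime ∧ ¬ q ∣ k).card * Real.log Y := by
    rw [Finset.filter_filter, ← nsmul_eq_mul]
    refine Finset.sum_le_card_nsmul _ _ _ fun q hq => ?_
    simp only [Finset.mem_filter, Finset.mem_Ioc] at hq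
    exact Real.log_le_log (by exact_mod_cast hq.2.1.pos) (by exact_mod_cast hq.1.2)
  linarith

theorem exists_coprime_of_cost_le {k z Y J T : ℕ} (hk : 1 < k) (hzY : z ≤ Y) (hY : 1 < Y) {B : ℝ}
    (hB : 0 ≤ B) (hJ : (J : ℝ) ≤ B * (k.totient / k))
    (hcost : Chebyshev.theta z + (B * ∏ q ∈ z.primesLE, (1 - 1 / (q : ℝ)) + 1) * Real.log Y
      + Real.log (Y + T + 1) ≤ Real.log k)
    (hθ : 2 * Real.log k ≤ Chebyshev.theta Y)
    (hD : ∑ r ∈ k.primeFactors.filter (z < ·), ((T : ℝ) / r + 1) < T) :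
    ∃ a < k, a.Coprime k ∧ ∀ j ≤ J, ¬ (a + j * k).Prime := by
  have hk0 : 0 < k := by omega
  have hX := add_one_mul_prod_le (z := z) hk0 hB hJ
  have hlogY : 0 < Real.log Y := Real.log_pos (by exact_mod_cast hY)
  have hlogT : 0 ≤ Real.log ((Y : ℝ) + T + 1) :=
    Real.log_nonneg (by have : (0 : ℝ) ≤ (Y : ℝ) + T := by positivity
                        linarith)
  refine exists_coprime_of_forall_not_prime hk (Y := Y) (by omega) ?_ ?_ hD
  · refine lt_of_le_of_lt (hX.trans ?_) (lt_add_one _)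
    refine le_of_mul_le_mul_right ?_ hlogY
    have := theta_sub_le_card_mul_log (k := k) hk0 hzY
    linarith
  · intro n hn
    have hY0 : 0 < Y := by omega
    have hpos := primorial_pos z
    suffices h : Real.log ((primorial z * Y ^ n * (Y + T + 1) : ℕ) : ℝ) ≤ Real.log k by
      exact_mod_cast (Real.log_le_log_iff (by positivity) (by exact_mod_cast hk0)).1 h
    have hp' : ((primorial z : ℕ) : ℝ) ≠ 0 := by exact_mod_cast hpos.ne'
    have hY' : (Y : ℝ) ≠ 0 := by exact_mod_cast hY0.ne'
    have hT' : (Y : ℝ) + T + 1 ≠ 0 := by positivity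
    push_cast
    rw [Real.log_mul (mul_ne_zero hp' (pow_ne_zero _ hY')) hT',
      Real.log_mul hp' (pow_ne_zero _ hY'), Real.log_pow]
    have hth : Real.log (primorial z) = Chebyshev.theta z := by
      rw [Chebyshev.theta_eq_log_primorial, Nat.floor_natCast]
    rw [hth]
    have := mul_le_mul_of_nonneg_right (hn.trans hX) hlogY.le
    linarith

theorem log_factorial_eq_sum_vonMangoldt {n N : ℕ} (h : n ≤ N) :
    Real.log n.factorial =
      ∑ d ∈ Finset.Ioc 0 N, ArithmeticFunction.vonMangoldt d * ((n / d : ℕ) : ℝ) := by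
  have h1 : ∑ d ∈ Finset.Ioc 0 N, ArithmeticFunction.vonMangoldt d * ((n / d : ℕ) : ℝ)
      = ∑ d ∈ Finset.Ioc 0 n, ArithmeticFunction.vonMangoldt d * ((n / d : ℕ) : ℝ) := by
    symm
    refine Finset.sum_subset (Finset.Ioc_subset_Ioc_right h) fun d _ hd' => ?_
    rw [Finset.mem_Ioc] at *
    rw [Nat.div_eq_of_lt (by omega)]
    simp
  rw [h1, ← ArithmeticFunction.sum_Ioc_mul_zeta_eq_sum, ArithmeticFunction.vonMangoldt_mul_zeta,
    Nat.factorial_eq_prod_range_add_one, Nat.cast_prod,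
    Real.log_prod fun i _ => by exact_mod_cast Nat.succ_ne_zero i]
  rw [show Finset.Ioc 0 n = Finset.Ico 1 (n + 1) by ext; simp; omega, Finset.sum_Ico_eq_sum_range]
  refine Finset.sum_congr rfl fun i _ => ?_
  simp [ArithmeticFunction.log_apply, add_comm]

theorem log_factorial_ge {n : ℕ} (hn : n ≠ 0) : n * Real.log n - n ≤ Real.log n.factorial := by
  have h := Stirling.le_log_factorial_stirling hn
  have h1 := Real.log_natCast_nonneg n
  have h2 : 0 ≤ Real.log (2 * Real.pi) := Real.log_nonneg (by linarith [Real.pi_gt_three])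
  linarith

theorem one_div_add_one_le_log_sub {n : ℕ} (hn : 1 ≤ n) :
    1 / ((n : ℝ) + 1) ≤ Real.log (n + 1) - Real.log n := by
  have hn' : (0 : ℝ) < n := by exact_mod_cast hn
  have h := Real.one_sub_inv_le_log_of_pos (show 0 < ((n : ℝ) + 1) / n by positivity)
  rw [Real.log_div (by positivity) hn'.ne'] at h
  refine le_trans (le_of_eq ?_) h
  field_simp
  ring

theorem log_factorial_le {n : ℕ} (hn : 1 ≤ n) :
    Real.log n.factorial ≤ n * Real.log n - n + Real.log n + 1 := by
  induction n, hn using Nat.le_induction with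
  | base => simp
  | succ n hn ih =>
    have hn' : (0 : ℝ) < n := by exact_mod_cast hn
    rw [Nat.factorial_succ, Nat.cast_mul, Real.log_mul (by positivity) (by positivity)]
    have h := mul_le_mul_of_nonneg_left (one_div_add_one_le_log_sub hn)
      (show (0 : ℝ) ≤ (n : ℝ) + 1 by positivity)
    rw [mul_one_div_cancel (by positivity)] at h
    push_cast
    linarith

theorem log_le_of_pow_le {y : ℝ} (hy : 0 < y) {a b : ℕ} (ha : 0 < a)
    (h : y ^ a ≤ (2.7182818283 : ℝ) ^ b) : Real.log y ≤ b / a := by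
  have h1 : y ^ a ≤ Real.exp b := by
    refine h.trans ?_
    rw [← Real.exp_one_pow]
    gcongr
    exact Real.exp_one_gt_d9.le
  have h2 := Real.log_le_log (by positivity) h1
  rw [Real.log_exp, Real.log_pow] at h2
  rw [le_div_iff₀ (by exact_mod_cast ha)]
  linarith

theorem le_log_of_le_pow {y : ℝ} {a b : ℕ} (ha : 0 < a)
    (h : (2.7182818286 : ℝ) ^ b ≤ y ^ a) : (b : ℝ) / a ≤ Real.log y := by
  have h1 : Real.exp b ≤ y ^ a := by
    refine le_trans ?_ h
    rw [← Real.exp_one_pow]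
    gcongr
    exact Real.exp_one_lt_d9.le
  have h2 := Real.log_le_log (Real.exp_pos _) h1
  rw [Real.log_exp, Real.log_pow] at h2
  rw [div_le_iff₀ (by exact_mod_cast ha)]
  linarith

set_option exponentiation.threshold 1000 in
theorem log_two_three_five_ge :
    27.636 ≤ 14 * Real.log 2 + 9 * Real.log 3 + 5 * Real.log 5 := by
  have h : 14 * Real.log 2 + 9 * Real.log 3 + 5 * Real.log 5
      = Real.log (2 ^ 14 * 3 ^ 9 * 5 ^ 5) := by
    rw [Real.log_mul (by norm_num) (by norm_num), Real.log_mul (by norm_num) (by norm_num),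
      Real.log_pow, Real.log_pow, Real.log_pow]
    norm_num
  rw [h]
  have := le_log_of_le_pow (y := 2 ^ 14 * 3 ^ 9 * 5 ^ 5) (a := 11) (b := 304) (by norm_num)
    (by norm_num)
  norm_num at this ⊢
  linarith

theorem psi_thirty_mul_ge {m : ℕ} (hm : 1 ≤ m) :
    27.636 * m - 3 * Real.log (30 * m) - 3 ≤ Chebyshev.psi (30 * m : ℕ) := by
  have hm' : (0 : ℝ) < m := by exact_mod_cast hm
  have key : Real.log (30 * m).factorial + Real.log m.factorial ≤
      Real.log (15 * m).factorial + Real.log (10 * m).factorial + Real.log (6 * m).factorial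
        + Chebyshev.psi (30 * m : ℕ) := by
    rw [log_factorial_eq_sum_vonMangoldt (le_refl (30 * m)),
      log_factorial_eq_sum_vonMangoldt (show m ≤ 30 * m by omega),
      log_factorial_eq_sum_vonMangoldt (show 15 * m ≤ 30 * m by omega),
      log_factorial_eq_sum_vonMangoldt (show 10 * m ≤ 30 * m by omega),
      log_factorial_eq_sum_vonMangoldt (show 6 * m ≤ 30 * m by omega), Chebyshev.psi,
      Nat.floor_natCast, ← Finset.sum_add_distrib, ← Finset.sum_add_distrib,
      ← Finset.sum_add_distrib, ← Finset.sum_add_distrib]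
    refine Finset.sum_le_sum fun d _ => ?_
    have hdiv : ∀ a b : ℕ, 0 < b → a * b = 30 → a * m / d = 30 * m / d / b := fun a b hb hab => by
      rw [Nat.div_div_eq_div_mul, mul_comm d b, ← Nat.div_div_eq_div_mul]
      congr 1
      rw [← hab, show a * b * m = a * m * b by ring, Nat.mul_div_cancel _ hb]
    have h1 := hdiv 1 30 (by norm_num) (by norm_num)
    rw [one_mul] at h1
    have h : 30 * m / d + m / d ≤ 15 * m / d + 10 * m / d + 6 * m / d + 1 := by
      rw [h1, hdiv 15 2 (by norm_num) (by norm_num), hdiv 10 3 (by norm_num) (by norm_num),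
        hdiv 6 5 (by norm_num) (by norm_num)]
      omega
    have h' : ((30 * m / d : ℕ) : ℝ) + (m / d : ℕ) ≤
        (15 * m / d : ℕ) + (10 * m / d : ℕ) + (6 * m / d : ℕ) + 1 := by exact_mod_cast h
    have h0 := ArithmeticFunction.vonMangoldt_nonneg (n := d)
    nlinarith
  have l30 := log_factorial_ge (n := 30 * m) (by omega)
  have l1 := log_factorial_ge (n := m) (by omega)
  have u15 := log_factorial_le (n := 15 * m) (by omega)
  have u10 := log_factorial_le (n := 10 * m) (by omega)
  have u6 := log_factorial_le (n := 6 * m) (by omega)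
  have e30 : Real.log 30 = Real.log 2 + Real.log 3 + Real.log 5 := by
    rw [← Real.log_mul (by norm_num) (by norm_num), ← Real.log_mul (by norm_num) (by norm_num)]
    norm_num
  have e15 : Real.log 15 = Real.log 3 + Real.log 5 := by
    rw [← Real.log_mul (by norm_num) (by norm_num)]; norm_num
  have e10 : Real.log 10 = Real.log 2 + Real.log 5 := by
    rw [← Real.log_mul (by norm_num) (by norm_num)]; norm_num
  have e6 : Real.log 6 = Real.log 2 + Real.log 3 := by
    rw [← Real.log_mul (by norm_num) (by norm_num)]; norm_num
  push_cast at *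
  rw [Real.log_mul (by norm_num) hm'.ne'] at l30 u15 u10 u6 ⊢
  rw [e30] at l30 ⊢
  rw [e15] at u15
  rw [e10] at u10
  rw [e6] at u6
  have p2 : 0 ≤ Real.log 2 := Real.log_nonneg (by norm_num)
  have p3 : 0 ≤ Real.log 3 := Real.log_nonneg (by norm_num)
  have p5 : 0 ≤ Real.log 5 := Real.log_nonneg (by norm_num)
  have hA := mul_le_mul_of_nonneg_right log_two_three_five_ge hm'.le
  linarith

theorem psi_ge_mul_sub {x : ℝ} (hx : 30 ≤ x) :
    0.9212 * x - 3 * Real.log x - 31 ≤ Chebyshev.psi x := by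
  set m := ⌊x / 30⌋₊ with hm
  have h1 : (m : ℝ) ≤ x / 30 := Nat.floor_le (by positivity)
  have h2 : x / 30 < m + 1 := Nat.lt_floor_add_one _
  have hm1 : 1 ≤ m := Nat.le_floor (by rw [Nat.cast_one, le_div_iff₀] <;> linarith)
  have h3 := psi_thirty_mul_ge hm1
  have h4 : Chebyshev.psi (30 * m : ℕ) ≤ Chebyshev.psi x :=
    Chebyshev.psi_mono (by push_cast; linarith)
  have h5 : Real.log (30 * m) ≤ Real.log x :=
    Real.log_le_log (by have : (1 : ℝ) ≤ m := by exact_mod_cast hm1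
                        linarith) (by linarith)
  linarith

theorem theta_ge_mul {x : ℝ} (hx : 18900 ≤ x) : 0.8511 * x ≤ Chebyshev.theta x := by
  have hx0 : 0 ≤ x := by linarith
  have h1 := psi_ge_mul_sub (show 30 ≤ x by linarith)
  have h2 := Chebyshev.psi_sub_theta_le_psi_add_psi_add_psi x
  set u := x ^ (6 : ℝ)⁻¹ with hu
  have hu6 : u ^ 6 = x := by
    rw [hu, ← Real.rpow_natCast, ← Real.rpow_mul hx0]; norm_num
  have hu2 : x ^ (3 : ℝ)⁻¹ = u ^ 2 := by
    rw [hu, ← Real.rpow_natCast, ← Real.rpow_mul hx0]; norm_num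
  have hu3 : x ^ (2 : ℝ)⁻¹ = u ^ 3 := by
    rw [hu, ← Real.rpow_natCast, ← Real.rpow_mul hx0]; norm_num
  have hu5 : x ^ (5 : ℝ)⁻¹ ≤ u ^ 2 := by
    rw [← hu2]
    exact Real.rpow_le_rpow_of_exponent_le (by linarith) (by norm_num)
  have hu0 : 0 ≤ u := Real.rpow_nonneg hx0 _
  have hu5' : 5 ≤ u := by
    by_contra! hlt
    have : u ^ 6 ≤ 5 ^ 6 := by gcongr
    linarith
  have hu137 : 137 ≤ u ^ 3 := by
    by_contra! hlt
    have : (u ^ 3) ^ 2 ≤ 137 ^ 2 := by gcongr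
    have h : (u ^ 3) ^ 2 = u ^ 6 := by ring
    linarith
  have hlog4 : Real.log 4 ≤ 1.3863 := by
    rw [show (4 : ℝ) = 2 ^ 2 by norm_num, Real.log_pow]
    have := Real.log_two_lt_d9
    push_cast
    linarith
  have hpsi : ∀ y : ℝ, 0 ≤ y → Chebyshev.psi y ≤ 5.3863 * y := fun y hy =>
    (Chebyshev.psi_le_const_mul_self hy).trans (mul_le_mul_of_nonneg_right (by linarith) hy)
  rw [hu2, hu3] at h2
  have h3 := hpsi (u ^ 3) (by positivity)
  have h4 := hpsi (u ^ 2) (by positivity)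
  have h5 := (hpsi _ (Real.rpow_nonneg hx0 _)).trans
    (mul_le_mul_of_nonneg_left hu5 (by norm_num : (0 : ℝ) ≤ 5.3863))
  have h6 : 5 * u ^ 2 ≤ u ^ 3 := by nlinarith [sq_nonneg u]
  have h7 : 137 * u ^ 3 ≤ x := by
    have : u ^ 3 * u ^ 3 = x := by rw [← hu6]; ring
    nlinarith
  have h8 : Real.log x ≤ 9 + x / 20000 := by
    have h9 : (20000 : ℝ) ≤ Real.exp 10 := by
      have : Real.exp 10 = Real.exp 1 ^ 10 := by rw [← Real.exp_nat_mul]; norm_num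
      rw [this]
      calc (20000 : ℝ) ≤ 2.7182818283 ^ 10 := by norm_num
        _ ≤ _ := by gcongr; exact Real.exp_one_gt_d9.le
    have h10 := Real.log_le_sub_one_of_pos (show 0 < x / Real.exp 10 by positivity)
    rw [Real.log_div (by linarith) (Real.exp_pos _).ne', Real.log_exp] at h10
    have h11 : x / Real.exp 10 ≤ x / 20000 := by gcongr
    linarith
  linarith

theorem one_div_card_add_one_le_prod (S : Finset ℕ) (hS : ∀ p ∈ S, 2 ≤ p) :
    1 / ((S.card : ℝ) + 1) ≤ ∏ p ∈ S, (1 - 1 / (p : ℝ)) := by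
  induction S using Finset.induction_on_max with
  | empty => simp
  | insert a S ha ih =>
    have haS : a ∉ S := fun h => lt_irrefl _ (ha a h)
    have hsub : insert a S ⊆ Finset.Icc 2 a := fun p hp => by
      rw [Finset.mem_Icc]
      refine ⟨hS p hp, ?_⟩
      rcases Finset.mem_insert.1 hp with rfl | h
      · exact le_rfl
      · exact (ha p h).le
    have hcard := Finset.card_le_card hsub
    rw [Finset.card_insert_of_notMem haS, Nat.card_Icc] at hcard
    have ha2 : 2 ≤ a := hS a (Finset.mem_insert_self _ _)
    have hle : (S.card : ℝ) + 2 ≤ a := by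
      have : S.card + 2 ≤ a := by omega
      exact_mod_cast this
    rw [Finset.prod_insert haS, Finset.card_insert_of_notMem haS]
    have h1 := ih fun p hp => hS p (Finset.mem_insert_of_mem hp)
    have h2 : 1 / (a : ℝ) ≤ 1 / ((S.card : ℝ) + 2) := by gcongr
    have h3 : 1 / ((S.card : ℝ) + 2) ≤ 1 := by
      rw [div_le_one (by positivity)]
      have : (0 : ℝ) ≤ S.card := by positivity
      linarith
    push_cast
    calc 1 / ((S.card : ℝ) + 1 + 1)
        = (1 - 1 / ((S.card : ℝ) + 2)) * (1 / ((S.card : ℝ) + 1)) := by field_simp; ring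
      _ ≤ (1 - 1 / (a : ℝ)) * ∏ p ∈ S, (1 - 1 / (p : ℝ)) := by
          refine mul_le_mul (by linarith) h1 (by positivity) (by linarith)

theorem le_totient_mul_card_primeFactors_add_one (k : ℕ) :
    (k : ℝ) ≤ k.totient * (k.primeFactors.card + 1) := by
  have h := Nat.totient_eq_mul_prod_factors k
  have h' : (k.totient : ℝ) = k * ∏ p ∈ k.primeFactors, (1 - 1 / (p : ℝ)) := by
    have := congrArg (fun x : ℚ => (x : ℝ)) h
    push_cast at this
    simpa using this
  have h1 := one_div_card_add_one_le_prod k.primeFactors fun p hp =>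
    (Nat.prime_of_mem_primeFactors hp).two_le
  rw [div_le_iff₀ (by positivity)] at h1
  rw [h', mul_assoc]
  exact le_mul_of_one_le_right (by positivity) h1

theorem card_primeFactors_le {k : ℕ} (hk : 0 < k) :
    (k.primeFactors.card : ℝ) ≤ 1.45 * Real.log k := by
  have h := log_prod_primeFactors_le hk
  have h1 : k.primeFactors.card • Real.log 2 ≤ ∑ r ∈ k.primeFactors, Real.log r :=
    Finset.card_nsmul_le_sum _ _ _ fun r hr => Real.log_le_log (by norm_num)
      (by exact_mod_cast (Nat.prime_of_mem_primeFactors hr).two_le)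
  rw [nsmul_eq_mul] at h1
  have h2 := Real.log_two_gt_d9
  have h3 : (0 : ℝ) ≤ k.primeFactors.card := by positivity
  nlinarith

set_option exponentiation.threshold 1000 in
theorem log_ten_ge : 8059 ≤ 3500 * Real.log 10 := by
  have := le_log_of_le_pow (y := 10) (a := 271) (b := 624) (by norm_num) (by norm_num)
  norm_num at this
  linarith

theorem log_le_add_div_sub_one {c y : ℝ} (hc : 0 < c) (hy : 0 < y) :
    Real.log y ≤ Real.log c + y / c - 1 := by
  have h := Real.log_le_sub_one_of_pos (div_pos hy hc)
  rw [Real.log_div hy.ne' hc.ne'] at h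
  linarith

theorem add_card_primeFactors_le_primeCounting {k : ℕ} (hk : 8059 ≤ Real.log k) :
    k.totient + k.primeFactors.card ≤
      Nat.primeCounting ⌊1.087 * k.totient * Real.log k⌋₊ := by
  have hk0 : 0 < k := Nat.pos_of_ne_zero fun h => by
    rw [h] at hk; norm_num at hk
  have hk' : (0 : ℝ) < k := by exact_mod_cast hk0
  set L := Real.log k with hL
  set w : ℝ := (k.primeFactors.card : ℝ) with hw
  set f : ℝ := (k.totient : ℝ) with hf
  have hw1 : w ≤ 1.45 * L := card_primeFactors_le hk0
  have hw0 : 0 ≤ w := by positivity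
  have hfk : f ≤ k := Nat.cast_le.2 (Nat.totient_le k)
  have hkf : (k : ℝ) ≤ f * (w + 1) := le_totient_mul_card_primeFactors_add_one k
  have hkL : L ^ 4 / 24 ≤ k := by
    have h := Real.pow_div_factorial_le_exp L (by linarith) 4
    rw [Real.exp_log hk'] at h
    simpa [Nat.factorial] using h
  have hf0 : 0 ≤ f := by positivity
  have hbig : 100000 * L ≤ f := by
    by_contra! hlt
    have h1 : f * (w + 1) ≤ 100000 * L * (1.5 * L) := by
      refine mul_le_mul hlt.le (by linarith) (by linarith) (by linarith)
    have h2 : 24 * 150000 * L ^ 2 < L ^ 2 * L ^ 2 := by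
      refine mul_lt_mul_of_pos_right ?_ (by positivity)
      nlinarith
    linarith [show L ^ 2 * L ^ 2 = L ^ 4 by ring]
  set x : ℝ := 1.087 * f * L with hx
  have hx30 : 30 ≤ x := by rw [hx]; nlinarith
  have hlogx : Real.log x ≤ 1.00113 * L := by
    have h1 : x ≤ k * (1.087 * L) := by
      rw [hx]; nlinarith
    refine (Real.log_le_log (by linarith) h1).trans ?_
    rw [Real.log_mul hk'.ne' (by positivity), ← hL]
    have h2 := log_le_add_div_sub_one (c := 8760) (y := 1.087 * L) (by norm_num) (by positivity)
    have h3 := log_le_of_pow_le (y := 8760) (a := 12) (b := 109) (by norm_num) (by norm_num)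
      (by norm_num)
    norm_num at h3
    linarith
  have h1 := psi_ge_mul_sub hx30
  have h2 := Chebyshev.psi_le_primeCounting_mul_log' x
  have hlx : 0 < Real.log x := Real.log_pos (by linarith)
  suffices h : (f + w) * Real.log x ≤ (Nat.primeCounting ⌊x⌋₊ : ℝ) * Real.log x by
    have := le_of_mul_le_mul_right h hlx
    rw [hf, hw] at this
    exact_mod_cast this
  refine le_trans ?_ (h1.trans h2)
  have h3 : (f + w + 3) * Real.log x ≤ (f + w + 3) * (1.00113 * L) := by gcongr
  have h4 : 0.9212 * x = 1.0013444 * (f * L) := by rw [hx]; ring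
  have h5 : (w + 3) * L ≤ 1.5 * L * L := by
    refine mul_le_mul_of_nonneg_right (by linarith) (by linarith)
  have h6 : 100000 * L * L ≤ f * L := by
    refine mul_le_mul_of_nonneg_right hbig (by linarith)
  nlinarith

theorem nthPrimeNotDvd_prime {k : ℕ} (hk : 0 < k) (i : ℕ) : (nthPrimeNotDvd k i).Prime := by
  have hinf : {p : ℕ | p.Prime ∧ ¬ p ∣ k}.Infinite := by
    refine (Nat.infinite_setOfPred_prime.sdiff (k.divisors.finite_toSet)).mono fun p hp => ?_
    refine ⟨hp.1, fun h => hp.2 ?_⟩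
    exact Finset.mem_coe.2 (Nat.mem_divisors.2 ⟨h, hk.ne'⟩)
  exact (Nat.nth_mem_of_infinite hinf i).1

theorem nthPrimeNotDvd_le {k n i : ℕ} (hk : 0 < k)
    (h : i + k.primeFactors.card < n.primeCounting) : nthPrimeNotDvd k i ≤ n := by
  refine Nat.lt_add_one_iff.1 (Nat.nth_lt_of_lt_count ?_)
  rw [Nat.count_eq_card_filter_range]
  have h1 : (Finset.range (n + 1)).filter Nat.Prime ⊆
      (Finset.range (n + 1)).filter (fun p => p.Prime ∧ ¬ p ∣ k) ∪ k.primeFactors := by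
    intro p hp
    rw [Finset.mem_filter] at hp
    rw [Finset.mem_union, Finset.mem_filter, Nat.mem_primeFactors]
    by_cases hpk : p ∣ k
    · exact Or.inr ⟨hp.2, hpk, hk.ne'⟩
    · exact Or.inl ⟨hp.1, hp.2, hpk⟩
  have h2 := (Finset.card_le_card h1).trans (Finset.card_union_le _ _)
  rw [Nat.primeCounting, Nat.primeCounting', Nat.count_eq_card_filter_range] at h
  have h3 := h.trans_le h2
  omega

/-- It suffices to find a reduced residue whose class has no small prime. -/
theorem not_isPInteger_of_forall_exists {k : ℕ} (hk : 8059 ≤ Real.log k)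
    (h : ∀ J : ℕ, (J : ℝ) ≤ 1.087 * Real.log k * (k.totient / k) →
      ∃ a < k, a.Coprime k ∧ ∀ j ≤ J, ¬ (a + j * k).Prime) : ¬ IsPInteger k := by
  rintro ⟨hk1, -, himage⟩
  have hk0 : (0 : ℝ) < k := by
    have : 0 < k := by omega
    exact_mod_cast this
  set x := 1.087 * k.totient * Real.log k with hx
  have hx0 : 0 ≤ x := by positivity
  have hJ : ((⌊x / k⌋₊ : ℕ) : ℝ) ≤ 1.087 * Real.log k * (k.totient / k) := by
    refine (Nat.floor_le (by positivity)).trans (le_of_eq ?_)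
    rw [hx]; ring
  obtain ⟨a, hak, hac, ha⟩ := h _ hJ
  have hmem : a ∈ {r | r < k ∧ Nat.Coprime r k} := ⟨hak, hac⟩
  rw [← himage] at hmem
  obtain ⟨i, hi, hia⟩ := hmem
  simp only at hia
  have hprime := nthPrimeNotDvd_prime (k := k) (by omega) i
  have hle : nthPrimeNotDvd k i ≤ ⌊x⌋₊ := by
    refine nthPrimeNotDvd_le (by omega) ?_
    have := add_card_primeFactors_le_primeCounting hk
    rw [← hx] at this
    rw [Set.mem_Iio] at hi
    omega
  have hdiv : nthPrimeNotDvd k i / k ≤ ⌊x / k⌋₊ := by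
    rw [Nat.floor_div_natCast]
    exact Nat.div_le_div_right hle
  refine ha _ hdiv ?_
  rw [← hia, mul_comm, Nat.mod_add_div]
  exact hprime

theorem card_filter_lt_primeFactors_mul_log_le {k z : ℕ} (hk : 0 < k) :
    ((k.primeFactors.filter (z < ·)).card : ℝ) * Real.log z ≤ Real.log k := by
  rcases Nat.eq_zero_or_pos z with rfl | hz
  · simpa using Real.log_natCast_nonneg k
  refine le_trans ?_ (log_prod_primeFactors_le hk)
  rw [← nsmul_eq_mul]
  refine le_trans (Finset.card_nsmul_le_sum _ (fun r : ℕ => Real.log r) _ fun r hr => ?_)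
    (Finset.sum_le_sum_of_subset_of_nonneg (Finset.filter_subset _ _) fun r _ _ =>
      Real.log_natCast_nonneg r)
  exact Real.log_le_log (by exact_mod_cast hz) (by exact_mod_cast (Finset.mem_filter.1 hr).2.le)

theorem sum_large_primeFactors_le {k z x : ℕ} (hk : 0 < k) (hz : 1 < z) (hzx : z ≤ x) {s : ℝ}
    (hs : ∑ p ∈ (Finset.Ioc z x).filter Nat.Prime, 1 / (p : ℝ) ≤ s) (T : ℕ) :
    ∑ r ∈ k.primeFactors.filter (z < ·), ((T : ℝ) / r + 1)
      ≤ T * (s + Real.log k / (x * Real.log x)) + Real.log k / Real.log z := by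
  have hlz : 0 < Real.log z := Real.log_pos (by exact_mod_cast hz)
  have hlx : 0 < Real.log x := Real.log_pos (by exact_mod_cast (by omega : 1 < x))
  have hx : (0 : ℝ) < x := by exact_mod_cast (by omega : 0 < x)
  have hcard : ((k.primeFactors.filter (z < ·)).card : ℝ) ≤ Real.log k / Real.log z := by
    rw [le_div_iff₀ hlz]
    exact card_filter_lt_primeFactors_mul_log_le hk
  have hrec : ∑ r ∈ k.primeFactors.filter (z < ·), 1 / (r : ℝ)
      ≤ s + Real.log k / (x * Real.log x) := by
    rw [← Finset.sum_filter_add_sum_filter_not (k.primeFactors.filter (z < ·)) (fun r => r ≤ x)]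
    refine add_le_add (le_trans ?_ hs) ?_
    · refine Finset.sum_le_sum_of_subset_of_nonneg (fun r hr => ?_) fun r _ _ => by positivity
      simp only [Finset.mem_filter, Nat.mem_primeFactors, Finset.mem_Ioc] at hr ⊢
      tauto
    · have h1 := Finset.sum_le_card_nsmul
        ((k.primeFactors.filter (z < ·)).filter (fun r => ¬ r ≤ x)) (fun r : ℕ => 1 / (r : ℝ))
        (1 / x) fun r hr => by
          have : (x : ℝ) ≤ r := by
            exact_mod_cast (not_le.1 (Finset.mem_filter.1 hr).2).le
          gcongr
      refine h1.trans ?_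
      have h2 : ((k.primeFactors.filter (z < ·)).filter (fun r => ¬ r ≤ x)).card
          ≤ (k.primeFactors.filter (x < ·)).card := by
        refine Finset.card_le_card fun r hr => ?_
        simp only [Finset.mem_filter, not_le] at hr ⊢
        tauto
      have h3 := card_filter_lt_primeFactors_mul_log_le (z := x) hk
      have h4 : (((k.primeFactors.filter (z < ·)).filter (fun r => ¬ r ≤ x)).card : ℝ)
          ≤ Real.log k / Real.log x := by
        rw [le_div_iff₀ hlx]
        refine le_trans ?_ h3
        gcongr
      rw [nsmul_eq_mul, mul_one_div, mul_comm (x : ℝ), ← div_div]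
      gcongr
  calc ∑ r ∈ k.primeFactors.filter (z < ·), ((T : ℝ) / r + 1)
      = T * ∑ r ∈ k.primeFactors.filter (z < ·), 1 / (r : ℝ)
        + (k.primeFactors.filter (z < ·)).card := by
        rw [Finset.sum_add_distrib, Finset.mul_sum]
        simp [div_eq_mul_inv]
    _ ≤ _ := by gcongr

theorem not_isPInteger_of_cost_le {k z T : ℕ} {M : ℝ} (hk : 8059 ≤ Real.log k)
    (hz : z ≤ 2.35 * Real.log k) (hM : ∏ q ∈ z.primesLE, (1 - 1 / (q : ℝ)) ≤ M)
    (hcost : Chebyshev.theta z + (1.087 * Real.log k * M + 1) * Real.log (2.35 * Real.log k)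
      + Real.log (2.35 * Real.log k + T + 1) ≤ Real.log k)
    (hD : ∑ r ∈ k.primeFactors.filter (z < ·), ((T : ℝ) / r + 1) < T) : ¬ IsPInteger k := by
  set L := Real.log k with hL
  have hk1 : 1 < k := by
    by_contra! h
    interval_cases k <;> norm_num at hL <;> linarith
  refine not_isPInteger_of_forall_exists hk fun J hJ => ?_
  have hYle : ((⌊2.35 * L⌋₊ : ℕ) : ℝ) ≤ 2.35 * L := Nat.floor_le (by linarith)
  have hY1 : 1 < ⌊2.35 * L⌋₊ := Nat.lt_of_lt_of_le (by norm_num : 1 < 2)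
    (Nat.le_floor (by push_cast; linarith))
  have hY0 : (0 : ℝ) < (⌊2.35 * L⌋₊ : ℕ) := by exact_mod_cast (by omega : 0 < ⌊2.35 * L⌋₊)
  have hM0 : 0 ≤ M := le_trans (Finset.prod_nonneg fun q hq =>
    (one_sub_one_div_prime_mem (Nat.mem_primesLE.1 hq).2).1.le) hM
  refine exists_coprime_of_cost_le hk1 (Nat.le_floor hz) hY1 (by positivity) hJ ?_ ?_ hD
  · refine le_trans ?_ hcost
    have hlog : 0 ≤ Real.log (2.35 * L) := Real.log_nonneg (by linarith)
    gcongr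
  · rw [← hL]
    have h1 := theta_ge_mul (x := 2.35 * L) (by linarith)
    rw [Chebyshev.theta_eq_theta_coe_floor] at h1
    linarith

/-- A test for primality, exact below `101 ^ 2`; above, it looks for prime factors below `100`. -/
def passesSieve (n : ℕ) : Bool :=
  bif Nat.ble n 97 then Nat.testBit 159085582874019712269820766380 n
  else Nat.beq (Nat.gcd n 2305567963945518424753102147331756070) 1

/-- The product of `w` over the integers in `[n, n + 2 ^ d)` passing the sieve. -/
def sieveProd (w : ℕ → ℕ) (d : ℕ) : ℕ → ℕ :=
  Nat.rec (fun n => bif passesSieve n then w n else 1)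
    (fun e ih n => Nat.mul (ih n) (ih (Nat.add n (Nat.pow 2 e)))) d

/-- The sum of `w` over the integers in `[n, n + 2 ^ d)` passing the sieve. -/
def sieveSum (w : ℕ → ℕ) (d : ℕ) : ℕ → ℕ :=
  Nat.rec (fun n => bif passesSieve n then w n else 0)
    (fun e ih n => Nat.add (ih n) (ih (Nat.add n (Nat.pow 2 e)))) d

theorem sieveProd_eq (w : ℕ → ℕ) (d n : ℕ) :
    sieveProd w d n = ∏ m ∈ (Finset.Ico n (n + 2 ^ d)).filter (passesSieve ·), w m := by
  induction d generalizing n with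
  | zero =>
    rw [Finset.prod_filter]
    simp [sieveProd, Bool.cond_eq_ite]
  | succ d ih =>
    have h : sieveProd w (d + 1) n = sieveProd w d n * sieveProd w d (n + 2 ^ d) := rfl
    rw [h, ih, ih, Finset.prod_filter, Finset.prod_filter, Finset.prod_filter,
      show n + 2 ^ (d + 1) = n + 2 ^ d + 2 ^ d by ring]
    exact Finset.prod_Ico_consecutive _ (Nat.le_add_right _ _) (Nat.le_add_right _ _)

theorem sieveSum_eq (w : ℕ → ℕ) (d n : ℕ) :
    sieveSum w d n = ∑ m ∈ (Finset.Ico n (n + 2 ^ d)).filter (passesSieve ·), w m := by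
  induction d generalizing n with
  | zero =>
    rw [Finset.sum_filter]
    simp [sieveSum, Bool.cond_eq_ite]
  | succ d ih =>
    have h : sieveSum w (d + 1) n = sieveSum w d n + sieveSum w d (n + 2 ^ d) := rfl
    rw [h, ih, ih, Finset.sum_filter, Finset.sum_filter, Finset.sum_filter,
      show n + 2 ^ (d + 1) = n + 2 ^ d + 2 ^ d by ring]
    exact Finset.sum_Ico_consecutive _ (Nat.le_add_right _ _) (Nat.le_add_right _ _)

theorem testBit_iff_prime : ∀ n ≤ 97, Nat.testBit 159085582874019712269820766380 n = true ↔ n.Prime := by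
  decide +kernel

theorem passesSieve_of_prime {n : ℕ} (hn : n.Prime) : passesSieve n = true := by
  by_cases h : n ≤ 97
  · have h1 := (testBit_iff_prime n h).2 hn
    rw [passesSieve, Nat.ble_eq.mpr h, cond_true, h1]
  · have h1 : Nat.ble n 97 = false := by
      rw [← Bool.not_eq_true, Nat.ble_eq]; exact h
    rw [passesSieve, h1, cond_false, Nat.beq_eq]
    refine hn.coprime_iff_not_dvd.2 fun hd => h ?_
    refine hn.dvd_factorial.1 (hd.trans ?_)
    decide +kernel

theorem prime_of_passesSieve {n : ℕ} (hn : n < 101 ^ 2) (h : passesSieve n = true) :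
    n.Prime := by
  by_cases h97 : n ≤ 97
  · rw [passesSieve, Nat.ble_eq.mpr h97, cond_true] at h
    exact (testBit_iff_prime n h97).1 h
  · have h1 : Nat.ble n 97 = false := by
      rw [← Bool.not_eq_true, Nat.ble_eq]; exact h97
    rw [passesSieve, h1, cond_false, Nat.beq_eq] at h
    by_contra hnp
    have h2 := Nat.minFac_sq_le_self (by omega) hnp
    have h3 : n.minFac < 101 := lt_of_pow_lt_pow_left₀ 2 (by norm_num) (h2.trans_lt hn)
    have h4 : ∀ q < 101, q.Prime → q ∣ 2305567963945518424753102147331756070 := by decide +kernel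
    have h5 : n.minFac.Prime := Nat.minFac_prime (by omega)
    have h6 := Nat.dvd_gcd (Nat.minFac_dvd n) (h4 _ h3 h5)
    rw [h] at h6
    exact h5.one_lt.ne' (Nat.dvd_one.1 h6)

theorem prod_primesLE_eq_sieveProd (w : ℕ → ℕ) {z d : ℕ} (hz : z < 101 ^ 2) (hd : z < 2 ^ d) :
    ∏ p ∈ z.primesLE, w p = sieveProd (fun p => bif Nat.ble p z then w p else 1) d 0 := by
  rw [sieveProd_eq]
  simp only [Bool.cond_eq_ite, Nat.ble_eq]
  rw [← Finset.prod_filter]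
  refine Finset.prod_congr ?_ fun _ _ => rfl
  ext p
  simp only [Nat.mem_primesLE, Finset.mem_filter, Finset.mem_Ico]
  constructor
  · rintro ⟨h1, h2⟩
    exact ⟨⟨⟨by omega, by omega⟩, passesSieve_of_prime h2⟩, h1⟩
  · rintro ⟨⟨⟨-, -⟩, h2⟩, h1⟩
    exact ⟨h1, prime_of_passesSieve (by omega) h2⟩

theorem sum_filter_prime_le_sieveSum (w : ℕ → ℕ) {z x d : ℕ} (hd : x < 2 ^ d) :
    ∑ p ∈ (Finset.Ioc z x).filter Nat.Prime, w p ≤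
      sieveSum (fun p => bif Nat.ble p z then 0 else bif Nat.ble p x then w p else 0) d 0 := by
  rw [sieveSum_eq]
  refine le_trans (le_of_eq (Finset.sum_congr rfl fun p hp => ?_))
    (Finset.sum_le_sum_of_subset fun p hp => ?_)
  · rw [Finset.mem_filter, Finset.mem_Ioc] at hp
    simp only [Bool.cond_eq_ite, Nat.ble_eq]
    rw [if_neg (by omega), if_pos hp.1.2]
  · rw [Finset.mem_filter, Finset.mem_Ioc] at hp
    rw [Finset.mem_filter, Finset.mem_Ico]
    exact ⟨⟨by omega, by omega⟩, passesSieve_of_prime hp.2⟩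

theorem theta_le_of_sieveProd_le {z d j : ℕ} (hz : z < 101 ^ 2) (hd : z < 2 ^ d)
    (h : sieveProd (fun p => bif Nat.ble p z then p else 1) d 0 ≤ 2 ^ j) :
    Chebyshev.theta z ≤ j * 0.69314719 := by
  rw [← prod_primesLE_eq_sieveProd (fun p => p) hz hd] at h
  have hpos : ∀ p ∈ z.primesLE, (p : ℝ) ≠ 0 := fun p hp => by
    exact_mod_cast (Nat.mem_primesLE.1 hp).2.ne_zero
  rw [Chebyshev.theta_eq_sum_primesLE_log, ← Real.log_prod hpos, ← Nat.cast_prod]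
  have h1 : ((∏ p ∈ z.primesLE, p : ℕ) : ℝ) ≤ 2 ^ j := by exact_mod_cast h
  have h2 : (0 : ℝ) < (∏ p ∈ z.primesLE, p : ℕ) := by
    rw [Nat.cast_prod]
    exact Finset.prod_pos fun p hp => (Nat.cast_nonneg p).lt_of_ne' (hpos p hp)
  refine (Real.log_le_log h2 h1).trans ?_
  rw [Real.log_pow]
  exact mul_le_mul_of_nonneg_left (by linarith [Real.log_two_lt_d9]) (by positivity)

theorem prod_one_sub_le_of_sieveProd_le {z d a b : ℕ} (hz : z < 101 ^ 2) (hd : z < 2 ^ d)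
    (hb : 0 < b)
    (h : sieveProd (fun p => bif Nat.ble p z then p - 1 else 1) d 0 * b
      ≤ a * sieveProd (fun p => bif Nat.ble p z then p else 1) d 0) :
    ∏ p ∈ z.primesLE, (1 - 1 / (p : ℝ)) ≤ (a / b : ℝ) := by
  rw [← prod_primesLE_eq_sieveProd (fun p => p) hz hd,
    ← prod_primesLE_eq_sieveProd (fun p => p - 1) hz hd] at h
  have hpos : ∀ p ∈ z.primesLE, (0 : ℝ) < p := fun p hp => by
    exact_mod_cast (Nat.mem_primesLE.1 hp).2.pos
  have h1 : ∏ p ∈ z.primesLE, (1 - 1 / (p : ℝ)) =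
      (∏ p ∈ z.primesLE, ((p - 1 : ℕ) : ℝ)) / ∏ p ∈ z.primesLE, (p : ℝ) := by
    rw [← Finset.prod_div_distrib]
    refine Finset.prod_congr rfl fun p hp => ?_
    have := hpos p hp
    rw [Nat.cast_sub (Nat.mem_primesLE.1 hp).2.one_lt.le]
    field_simp
    simp
  rw [h1, div_le_div_iff₀ (Finset.prod_pos hpos) (by exact_mod_cast hb)]
  rw [← Nat.cast_prod, ← Nat.cast_prod]
  exact_mod_cast h

theorem sum_one_div_le_of_sieveSum_le {z x d K c : ℕ} (hd : x < 2 ^ d) (hK : 0 < K)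
    (h : sieveSum (fun p => bif Nat.ble p z then 0 else bif Nat.ble p x then K / p + 1 else 0)
      d 0 ≤ c) :
    ∑ p ∈ (Finset.Ioc z x).filter Nat.Prime, 1 / (p : ℝ) ≤ (c / K : ℝ) := by
  have hK' : (0 : ℝ) < K := by exact_mod_cast hK
  rw [le_div_iff₀ hK', Finset.sum_mul]
  have h1 := (sum_filter_prime_le_sieveSum (fun p => K / p + 1) hd).trans h
  have h2 : ((∑ p ∈ (Finset.Ioc z x).filter Nat.Prime, (K / p + 1) : ℕ) : ℝ) ≤ c := by
    exact_mod_cast h1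
  refine le_trans ?_ h2
  push_cast
  refine Finset.sum_le_sum fun p hp => ?_
  have hp0 : (0 : ℝ) < p := by exact_mod_cast (Finset.mem_filter.1 hp).2.pos
  have h3 : K < (K / p + 1) * p := by
    have := Nat.lt_div_mul_add (a := K) (b := p) (by exact_mod_cast hp0)
    linarith
  have h4 : (K : ℝ) < ((K / p : ℕ) + 1) * p := by exact_mod_cast h3
  rw [one_div_mul_eq_div, div_le_iff₀ hp0]
  exact h4.le

theorem not_isPInteger_of_table {k z x T : ℕ} {a b c M s θ₀ lc C lz lx : ℝ}
    (ha : 8059 ≤ a) (hk : a ≤ Real.log k) (hkb : Real.log k ≤ b)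
    (hz : 1 < z) (hza : z ≤ 2.35 * a) (hzx : z ≤ x) (hc : 0 < c)
    (hM : ∏ q ∈ z.primesLE, (1 - 1 / (q : ℝ)) ≤ M) (hM0 : 0 ≤ M)
    (hθ : Chebyshev.theta z ≤ θ₀)
    (hs : ∑ p ∈ (Finset.Ioc z x).filter Nat.Prime, 1 / (p : ℝ) ≤ s)
    (hlc : Real.log (2.35 * c) ≤ lc) (hC : Real.log (2.35 * b + T + 1) ≤ C)
    (hlz0 : 0 < lz) (hlz : lz ≤ Real.log z) (hlx0 : 0 < lx) (hlx : lx ≤ Real.log x)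
    (hca : θ₀ + (1.087 * a * M + 1) * (lc + a / c - 1) + C ≤ a)
    (hcb : θ₀ + (1.087 * b * M + 1) * (lc + b / c - 1) + C ≤ b)
    (hD : T * (s + b / (x * lx)) + b / lz < T) : ¬ IsPInteger k := by
  set L := Real.log k with hL
  have hk0 : 0 < k := Nat.pos_of_ne_zero fun h => by
    rw [h] at hL; norm_num at hL; linarith
  have hx0 : (0 : ℝ) < x := by exact_mod_cast (by omega : 0 < x)
  refine not_isPInteger_of_cost_le (T := T) (ha.trans hk) (hza.trans (by linarith)) hM ?_ ?_
  · have h1 : Real.log (2.35 * L) ≤ lc + L / c - 1 := by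
      have h := log_le_add_div_sub_one (c := 2.35 * c) (y := 2.35 * L) (by positivity)
        (by linarith)
      rw [mul_div_mul_left _ _ (by norm_num)] at h
      linarith
    have h2 : Real.log (2.35 * L + T + 1) ≤ C := by
      refine le_trans (Real.log_le_log ?_ ?_) hC
      · have : (0 : ℝ) ≤ T := by positivity
        linarith
      · linarith
    have h3 : (1.087 * L * M + 1) * Real.log (2.35 * L)
        ≤ (1.087 * L * M + 1) * (lc + L / c - 1) := by
      have : 0 ≤ L := by linarith
      gcongr
    refine le_trans (add_le_add (add_le_add hθ h3) h2) ?_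
    -- the left side is a convex quadratic polynomial in `L`
    have hab : a ≤ b := hk.trans hkb
    rcases hab.eq_or_lt with rfl | hlt
    · have : L = a := le_antisymm hkb hk
      rw [this]; linarith
    · have h4 : 0 ≤ 1.087 * M / c * ((L - a) * (b - L)) := by
        have := mul_nonneg (sub_nonneg.2 hk) (sub_nonneg.2 hkb)
        positivity
      have h5 := mul_le_mul_of_nonneg_left hca (sub_nonneg.2 hkb)
      have h6 := mul_le_mul_of_nonneg_left hcb (sub_nonneg.2 hk)
      have h7 : 0 ≤ (b - a) * (1.087 * M / c * ((L - a) * (b - L))) :=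
        mul_nonneg (by linarith) h4
      refine le_of_mul_le_mul_left ?_ (sub_pos.2 hlt)
      have h8 : (b - L) * (θ₀ + (1.087 * a * M + 1) * (lc + a / c - 1) + C) +
          (L - a) * (θ₀ + (1.087 * b * M + 1) * (lc + b / c - 1) + C)
          - (b - a) * (θ₀ + (1.087 * L * M + 1) * (lc + L / c - 1) + C)
          = (b - a) * (1.087 * M / c * ((L - a) * (b - L))) := by
        field_simp
        ring
      have h9 : (b - L) * a + (L - a) * b = (b - a) * L := by ring
      linarith
  · refine lt_of_le_of_lt (sum_large_primeFactors_le hk0 hz hzx hs T) (lt_of_le_of_lt ?_ hD)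
    have hL0 : 0 ≤ L := by linarith
    have hb0 : 0 ≤ b := by linarith
    rw [← hL]
    gcongr

theorem prod_primesLE_thousand_le :
    ∏ q ∈ Nat.primesLE 1000, (1 - 1 / (q : ℝ)) ≤ 0.08097 := by
  have := prod_one_sub_le_of_sieveProd_le (z := 1000) (d := 10) (a := 8097) (b := 100000)
    (by norm_num) (by norm_num) (by norm_num) (by decide +kernel)
  norm_num at this ⊢
  exact this

theorem theta_thousand_le : Chebyshev.theta (1000 : ℕ) ≤ 956.5432 := by
  have := theta_le_of_sieveProd_le (z := 1000) (d := 10) (j := 1380)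
    (by norm_num) (by norm_num) (by decide +kernel)
  refine this.trans ?_
  norm_num

theorem sum_one_div_primes_thousand_le :
    ∑ p ∈ (Finset.Ioc 1000 4095).filter Nat.Prime, 1 / (p : ℝ) ≤ 0.184 := by
  have := sum_one_div_le_of_sieveSum_le (z := 1000) (x := 4095) (d := 12) (K := 100000000)
    (c := 18400000) (by norm_num) (by norm_num) (by decide +kernel)
  norm_num at this ⊢
  exact this

theorem le_log_thousand : 6.906 ≤ Real.log (1000 : ℕ) := by
  have := le_log_of_le_pow (y := 1000) (a := 32) (b := 221) (by norm_num) (by norm_num)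
  norm_num at this ⊢
  linarith

theorem log_le_of_le_exp_nat {y : ℝ} (hy : 0 < y) (n : ℕ) (h : y ≤ (2.7182818283 : ℝ) ^ n) :
    Real.log y ≤ n := by
  have := log_le_of_pow_le (a := 1) (b := n) hy one_pos (by rwa [pow_one])
  simpa using this

set_option exponentiation.threshold 1000 in
theorem not_isPInteger_of_log_le_20000 {k : ℕ} (hk : 8059 ≤ Real.log k)
    (hkb : Real.log k ≤ 20000) : ¬ IsPInteger k := by
  have hlx := le_log_of_le_pow (y := (4095 : ℕ)) (a := 10) (b := 83) (by norm_num) (by norm_num)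
  rcases le_total (Real.log k) 13000 with h | h
  · have hlc := log_le_of_pow_le (y := 2.35 * 10000) (a := 15) (b := 151) (by norm_num)
      (by norm_num) (by norm_num)
    have hC := log_le_of_le_exp_nat (y := 2.35 * 13000 + (400000 : ℕ) + 1) (by norm_num) 13
      (by norm_num)
    refine not_isPInteger_of_table le_rfl hk h (by norm_num) (by norm_num) (by norm_num)
      (by norm_num) prod_primesLE_thousand_le (by norm_num) theta_thousand_le
      sum_one_div_primes_thousand_le hlc hC (by norm_num) le_log_thousand (by norm_num) hlx
      ?_ ?_ ?_ <;> norm_num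
  · have hlc := log_le_of_pow_le (y := 2.35 * 16000) (a := 28) (b := 295) (by norm_num)
      (by norm_num) (by norm_num)
    have hC := log_le_of_le_exp_nat (y := 2.35 * 20000 + (400000 : ℕ) + 1) (by norm_num) 14
      (by norm_num)
    refine not_isPInteger_of_table (by norm_num) h hkb (by norm_num) (by norm_num) (by norm_num)
      (by norm_num) prod_primesLE_thousand_le (by norm_num) theta_thousand_le
      sum_one_div_primes_thousand_le hlc hC (by norm_num) le_log_thousand (by norm_num) hlx
      ?_ ?_ ?_ <;> norm_num

theorem not_isPInteger_of_log_le_100000 {k : ℕ} (hk : 20000 ≤ Real.log k)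
    (hkb : Real.log k ≤ 100000) : ¬ IsPInteger k := by
  have hM := prod_one_sub_le_of_sieveProd_le (z := 2500) (d := 12) (a := 7160) (b := 100000)
    (by norm_num) (by norm_num) (by norm_num) (by decide +kernel)
  have hθ := theta_le_of_sieveProd_le (z := 2500) (d := 12) (j := 3511)
    (by norm_num) (by norm_num) (by decide +kernel)
  have hs := sum_one_div_le_of_sieveSum_le (z := 2500) (x := 16383) (d := 14) (K := 100000000)
    (c := 21800000) (by norm_num) (by norm_num) (by decide +kernel)
  have hlz := le_log_of_le_pow (y := (2500 : ℕ)) (a := 17) (b := 133) (by norm_num) (by norm_num)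
  have hlx := le_log_of_le_pow (y := (16383 : ℕ)) (a := 10) (b := 97) (by norm_num) (by norm_num)
  have hlc := log_le_of_pow_le (y := 2.35 * 60000) (a := 7) (b := 83) (by norm_num)
    (by norm_num) (by norm_num)
  have hC := log_le_of_le_exp_nat (y := 2.35 * 100000 + (2000000 : ℕ) + 1) (by norm_num) 15
    (by norm_num)
  refine not_isPInteger_of_table (by norm_num) hk hkb (by norm_num) (by norm_num) (by norm_num)
    (by norm_num) hM (by norm_num) hθ hs hlc hC (by norm_num) hlz (by norm_num) hlx
    ?_ ?_ ?_ <;> norm_num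

set_option exponentiation.threshold 1000 in
theorem not_isPInteger_of_log_le_250000 {k : ℕ} (hk : 100000 ≤ Real.log k)
    (hkb : Real.log k ≤ 250000) : ¬ IsPInteger k := by
  have hM := prod_one_sub_le_of_sieveProd_le (z := 6000) (d := 13) (a := 6447) (b := 100000)
    (by norm_num) (by norm_num) (by norm_num) (by decide +kernel)
  have hθ := theta_le_of_sieveProd_le (z := 6000) (d := 13) (j := 8503)
    (by norm_num) (by norm_num) (by decide +kernel)
  have hs := sum_one_div_le_of_sieveSum_le (z := 6000) (x := 32767) (d := 15) (K := 100000000)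
    (c := 19300000) (by norm_num) (by norm_num) (by decide +kernel)
  have hlz := le_log_of_le_pow (y := (6000 : ℕ)) (a := 13) (b := 113) (by norm_num) (by norm_num)
  have hlx := le_log_of_le_pow (y := (32767 : ℕ)) (a := 13) (b := 135) (by norm_num) (by norm_num)
  have hlc := log_le_of_pow_le (y := 2.35 * 160000) (a := 25) (b := 321) (by norm_num)
    (by norm_num) (by norm_num)
  have hC := log_le_of_le_exp_nat (y := 2.35 * 250000 + (5000000 : ℕ) + 1) (by norm_num) 16
    (by norm_num)
  refine not_isPInteger_of_table (by norm_num) hk hkb (by norm_num) (by norm_num) (by norm_num)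
    (by norm_num) hM (by norm_num) hθ hs hlc hC (by norm_num) hlz (by norm_num) hlx
    ?_ ?_ ?_ <;> norm_num

theorem mul_log_add_one_sub_le_log_factorial (n : ℕ) :
    n * Real.log (n + 1) - n ≤ Real.log n.factorial := by
  induction n with
  | zero => simp
  | succ n ih =>
    have hn : (0 : ℝ) < n + 1 := by positivity
    have h1 : Real.log (n + 2) ≤ Real.log (n + 1) + (n + 2) / (n + 1) - 1 :=
      log_le_add_div_sub_one hn (by linarith)
    have h2 : ((n : ℝ) + 1) * Real.log (n + 2) ≤ (n + 1) * Real.log (n + 1) + 1 := by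
      refine (mul_le_mul_of_nonneg_left h1 hn.le).trans (le_of_eq ?_)
      field_simp
      ring
    rw [Nat.factorial_succ, Nat.cast_mul, Real.log_mul (by positivity) (by positivity)]
    push_cast
    rw [add_assoc (n : ℝ) 1 1, one_add_one_eq_two]
    linarith

theorem log_factorial_le_mul_sum (n : ℕ) :
    Real.log n.factorial ≤ n * ∑ p ∈ n.primesLE, Real.log p / ((p : ℝ) - 1) := by
  rw [Real.log_nat_eq_sum_factorization, Finsupp.sum, Finset.mul_sum]
  have hsub : n.factorial.factorization.support ⊆ n.primesLE := fun p hp => by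
    rw [Nat.support_factorization, Nat.mem_primeFactors] at hp
    exact Nat.mem_primesLE.2 ⟨(hp.1.dvd_factorial).1 hp.2.1, hp.1⟩
  refine (Finset.sum_le_sum fun p hp => ?_).trans
    (Finset.sum_le_sum_of_subset_of_nonneg hsub fun p hp _ => ?_)
  · have hpp := (Nat.mem_primesLE.1 (hsub hp)).2
    have hp1 : (1 : ℝ) < p := by exact_mod_cast hpp.one_lt
    have h := Nat.sub_one_mul_factorization_factorial (n := n) hpp
    have h1 : ((p : ℝ) - 1) * n.factorial.factorization p ≤ n := by
      have : (p - 1) * n.factorial.factorization p ≤ n := by omega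
      have h2 : (((p - 1) * n.factorial.factorization p : ℕ) : ℝ) ≤ n := by exact_mod_cast this
      rwa [Nat.cast_mul, Nat.cast_sub hpp.one_le, Nat.cast_one] at h2
    rw [mul_div_assoc', le_div_iff₀ (by linarith)]
    nlinarith [Real.log_pos hp1]
  · have hp1 : (1 : ℝ) < p := by exact_mod_cast (Nat.mem_primesLE.1 hp).2.one_lt
    have := Real.log_pos hp1
    have : 0 < (p : ℝ) - 1 := by linarith
    positivity

theorem log_add_one_sub_one_le_sum {n : ℕ} (hn : 0 < n) :
    Real.log (n + 1) - 1 ≤ ∑ p ∈ n.primesLE, Real.log p / ((p : ℝ) - 1) := by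
  have hn' : (0 : ℝ) < n := by exact_mod_cast hn
  refine le_of_mul_le_mul_left ?_ hn'
  have h1 := mul_log_add_one_sub_le_log_factorial n
  have h2 := log_factorial_le_mul_sum n
  linarith

/-- Partial summation of `∑ log p / (p - 1)` against `1 / log n`. -/
theorem log_prod_one_sub_le_aux {N z : ℕ} (hN : 1 < N) (hz : N ≤ z) {e : ℝ}
    (he : 1 + ∑ p ∈ N.primesLE, Real.log p / ((p : ℝ) - 1) ≤ e) :
    Real.log (∏ p ∈ z.primesLE, (1 - 1 / (p : ℝ)))
      + (∑ p ∈ z.primesLE, Real.log p / ((p : ℝ) - 1) + 1 - e) / Real.log z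
      + (Real.log (Real.log z) + e / Real.log z) + 1 / z
    ≤ Real.log (∏ p ∈ N.primesLE, (1 - 1 / (p : ℝ)))
      + (Real.log (Real.log N) + e / Real.log N) + 1 / N := by
  induction z, hz using Nat.le_induction with
  | base =>
    have : (∑ p ∈ N.primesLE, Real.log p / ((p : ℝ) - 1) + 1 - e) / Real.log N ≤ 0 :=
      div_nonpos_of_nonpos_of_nonneg (by linarith) (Real.log_natCast_nonneg N)
    linarith
  | succ n hn ih =>
    refine le_trans ?_ ih
    have hn1 : (1 : ℝ) < n := by exact_mod_cast hN.trans_le hn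
    have hn0 : (0 : ℝ) < n := by linarith
    have hu : 0 < Real.log n := Real.log_pos hn1
    have hv : 0 < Real.log (n + 1) := Real.log_pos (by linarith)
    have huv : Real.log n ≤ Real.log (n + 1) := Real.log_le_log hn0 (by linarith)
    have hB := log_add_one_sub_one_le_sum (n := n) (by omega)
    have hM : 0 < ∏ p ∈ n.primesLE, (1 - 1 / (p : ℝ)) := Finset.prod_pos fun p hp =>
      (one_sub_one_div_prime_mem (Nat.mem_primesLE.1 hp).2).1
    have hlog : Real.log (Real.log (n + 1)) ≤
        Real.log (Real.log n) + Real.log (n + 1) / Real.log n - 1 :=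
      log_le_add_div_sub_one hu hv
    have hinv : 1 / Real.log (n + 1) ≤ 1 / Real.log n := one_div_le_one_div_of_le hu huv
    set B := ∑ p ∈ n.primesLE, Real.log p / ((p : ℝ) - 1) with hBdef
    set u := Real.log n
    set v := Real.log (n + 1)
    -- the increments coming from the change of weight
    have hmain : (B + 1 - e) / v + (Real.log v + e / v)
        ≤ (B + 1 - e) / u + (Real.log u + e / u) := by
      have h1 : 0 ≤ (B + 1 - v) * (1 / u - 1 / v) :=
        mul_nonneg (by linarith) (by linarith)
      have h2 : (B + 1 - v) * (1 / u - 1 / v) = (B + 1) / u - (B + 1) / v - v / u + 1 := by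
        field_simp
        ring
      have h3 : ∀ w, (B + 1 - e) / w + e / w = (B + 1) / w := fun w => by ring
      linarith [h3 u, h3 v]
    rw [Nat.primesLE_succ]
    push_cast
    have hrec : 1 / ((n : ℝ) + 1) ≤ 1 / n := one_div_le_one_div_of_le hn0 (by linarith)
    split_ifs with hp
    · rw [Finset.prod_insert (Nat.notMem_primesLE n), Finset.sum_insert (Nat.notMem_primesLE n),
        ← hBdef]
      obtain ⟨hp0, -⟩ := one_sub_one_div_prime_mem hp
      have h4 := Real.log_le_sub_one_of_pos hp0
      rw [Real.log_mul hp0.ne' hM.ne']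
      push_cast at h4 ⊢
      rw [add_sub_cancel_right]
      have h5 : (v / n + B + 1 - e) / v = 1 / n + (B + 1 - e) / v := by
        field_simp
        ring
      rw [h5]
      linarith
    · rw [← hBdef]
      linarith

theorem prod_one_sub_le_div_log {N z : ℕ} (hN : 1 < N) (hz : N ≤ z) {e : ℝ}
    (he : 1 + ∑ p ∈ N.primesLE, Real.log p / ((p : ℝ) - 1) ≤ e) :
    ∏ p ∈ z.primesLE, (1 - 1 / (p : ℝ)) ≤
      (∏ p ∈ N.primesLE, (1 - 1 / (p : ℝ))) * Real.log N
        * Real.exp (1 / N + e / Real.log N - 1) / Real.log z := by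
  have h := log_prod_one_sub_le_aux hN hz he
  have hN1 : (1 : ℝ) < N := by exact_mod_cast hN
  have hz1 : (1 : ℝ) < z := by exact_mod_cast hN.trans_le hz
  have hlN := Real.log_pos hN1
  have hlz := Real.log_pos hz1
  have hpos : ∀ n : ℕ, 0 < ∏ p ∈ n.primesLE, (1 - 1 / (p : ℝ)) := fun n =>
    Finset.prod_pos fun p hp => (one_sub_one_div_prime_mem (Nat.mem_primesLE.1 hp).2).1
  rw [le_div_iff₀ hlz]
  have hMz := hpos z
  have hMN := hpos N
  rw [← Real.log_le_log_iff (by positivity) (by positivity), Real.log_mul hMz.ne' hlz.ne',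
    Real.log_mul (by positivity) (Real.exp_pos _).ne', Real.log_mul hMN.ne' hlN.ne',
    Real.log_exp]
  have h1 : Real.log z - 1 ≤ ∑ p ∈ z.primesLE, Real.log p / ((p : ℝ) - 1) :=
    le_trans (by gcongr; linarith) (log_add_one_sub_one_le_sum (by omega))
  have h2 : (Real.log z - e) / Real.log z ≤
      (∑ p ∈ z.primesLE, Real.log p / ((p : ℝ) - 1) + 1 - e) / Real.log z := by
    gcongr
    linarith
  have h3 : (Real.log z - e) / Real.log z + e / Real.log z = 1 := by
    field_simp
    ring
  have h4 : 0 < 1 / (z : ℝ) := by positivity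
  linarith

theorem sum_log_div_sub_one_le_of_sieveProd_le {z d K j : ℕ} (hz : z < 101 ^ 2) (hd : z < 2 ^ d)
    (hK : 0 < K)
    (h : sieveProd (fun p => bif Nat.ble p z then p ^ (K / (p - 1) + 1) else 1) d 0 ≤ 2 ^ j) :
    ∑ p ∈ z.primesLE, Real.log p / ((p : ℝ) - 1) ≤ j * 0.69314719 / K := by
  rw [← prod_primesLE_eq_sieveProd (fun p => p ^ (K / (p - 1) + 1)) hz hd] at h
  have hK' : (0 : ℝ) < K := by exact_mod_cast hK
  have hpos : ∀ p ∈ z.primesLE, (0 : ℝ) < ((p ^ (K / (p - 1) + 1) : ℕ) : ℝ) := fun p hp => by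
    exact_mod_cast pow_pos (Nat.mem_primesLE.1 hp).2.pos _
  have h1 : ((∏ p ∈ z.primesLE, p ^ (K / (p - 1) + 1) : ℕ) : ℝ) ≤ 2 ^ j := by exact_mod_cast h
  rw [Nat.cast_prod] at h1
  have h2 := Real.log_le_log (Finset.prod_pos hpos) h1
  rw [Real.log_prod fun p hp => (hpos p hp).ne', Real.log_pow] at h2
  rw [le_div_iff₀ hK', Finset.sum_mul]
  refine le_trans (Finset.sum_le_sum fun p hp => ?_) (h2.trans
    (mul_le_mul_of_nonneg_left (by linarith [Real.log_two_lt_d9]) (by positivity)))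
  have hp2 := (Nat.mem_primesLE.1 hp).2.two_le
  have hp1 : 0 < ((p - 1 : ℕ) : ℝ) := by exact_mod_cast (by omega : 0 < p - 1)
  have h3 := (Nat.lt_div_mul_add (a := K) (b := p - 1) (by omega))
  have h4 : (K : ℝ) ≤ (((K / (p - 1) : ℕ) : ℝ) + 1) * ((p - 1 : ℕ) : ℝ) := by
    have : K ≤ (K / (p - 1) + 1) * (p - 1) := by rw [add_mul, one_mul]; exact h3.le
    exact_mod_cast this
  rw [Nat.cast_pow, Real.log_pow, div_mul_eq_mul_div]
  rw [Nat.cast_sub (by omega), Nat.cast_one] at hp1 h4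
  rw [div_le_iff₀ hp1]
  push_cast
  have := mul_le_mul_of_nonneg_left h4 (Real.log_natCast_nonneg p)
  linarith

theorem sum_log_div_sub_one_thousand_le :
    ∑ p ∈ Nat.primesLE 1000, Real.log p / ((p : ℝ) - 1) ≤ 6.3763 := by
  have := sum_log_div_sub_one_le_of_sieveProd_le (z := 1000) (d := 10) (K := 40000) (j := 367960)
    (by norm_num) (by norm_num) (by norm_num) (by decide +kernel)
  refine this.trans ?_
  norm_num

set_option exponentiation.threshold 1000 in
theorem prod_one_sub_le_of_thousand_le {z : ℕ} (hz : 1000 ≤ z) :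
    ∏ p ∈ z.primesLE, (1 - 1 / (p : ℝ)) ≤ 0.6 / Real.log z := by
  refine (prod_one_sub_le_div_log (N := 1000) (e := 7.3763) (by norm_num) hz
    (by linarith [sum_log_div_sub_one_thousand_le])).trans ?_
  have hl := le_log_of_le_pow (y := (1000 : ℕ)) (a := 54) (b := 373) (by norm_num) (by norm_num)
  have hu := log_le_of_pow_le (y := (1000 : ℕ)) (a := 76) (b := 525) (by norm_num) (by norm_num)
    (by norm_num)
  have hM := prod_primesLE_thousand_le
  have hexp : Real.exp (1 / (1000 : ℕ) + 7.3763 / Real.log (1000 : ℕ) - 1) ≤ 1.0715 := by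
    have h1 : 7.3763 / Real.log (1000 : ℕ) ≤ 7.3763 / (373 / 54) := by
      gcongr
      exact_mod_cast hl
    have h2 := Real.exp_bound' (x := 0.0689) (by norm_num) (by norm_num) (n := 3) (by norm_num)
    refine (Real.exp_le_exp.2 ?_).trans (h2.trans ?_)
    · norm_num at h1 ⊢
      linarith
    · norm_num [Finset.sum_range_succ, Nat.factorial]
  have hlz : 0 ≤ Real.log z := Real.log_natCast_nonneg z
  have h0 : 0 ≤ Real.log (1000 : ℕ) := Real.log_natCast_nonneg _
  gcongr
  calc (∏ p ∈ Nat.primesLE 1000, (1 - 1 / (p : ℝ))) * Real.log (1000 : ℕ)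
        * Real.exp (1 / (1000 : ℕ) + 7.3763 / Real.log (1000 : ℕ) - 1)
      ≤ 0.08097 * (525 / 76) * 1.0715 := by
        have hu' : Real.log (1000 : ℕ) ≤ 525 / 76 := by exact_mod_cast hu
        gcongr
    _ ≤ 0.6 := by norm_num

set_option exponentiation.threshold 1000 in
theorem not_isPInteger_of_le_log {k : ℕ} (hk : 250000 ≤ Real.log k) : ¬ IsPInteger k := by
  set L := Real.log k with hL
  have hk0 : 0 < k := Nat.pos_of_ne_zero fun h => by
    rw [h] at hL; norm_num at hL; linarith
  have hL0 : 0 < L := by linarith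
  set z := ⌊L / 10⌋₊ with hz
  have hzle : (z : ℝ) ≤ L / 10 := Nat.floor_le (by positivity)
  have hzge : L / 10.001 ≤ z := by
    have := Nat.lt_floor_add_one (L / 10)
    norm_num at this ⊢
    linarith
  have hz1000 : 1000 ≤ z := Nat.le_floor (by push_cast; linarith)
  have hz0 : (0 : ℝ) < z := by exact_mod_cast (by omega : 0 < z)
  have hl := le_log_of_le_pow (y := 250000) (a := 7) (b := 87) (by norm_num) (by norm_num)
  have hlogL : 12.4285 ≤ Real.log L := by
    have := Real.log_le_log (by norm_num) hk
    norm_num at hl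
    linarith
  have hlogz : Real.log L - 2.3031 ≤ Real.log z := by
    have h1 := Real.log_le_log (by positivity) hzge
    rw [Real.log_div hL0.ne' (by norm_num)] at h1
    have h2 := log_le_of_pow_le (y := 10.001) (a := 33) (b := 76) (by norm_num) (by norm_num)
      (by norm_num)
    norm_num at h1 h2 ⊢
    linarith
  have hlz0 : 0 < Real.log z := by linarith
  have hlogL' : Real.log L ≤ 12 + L / 250000 := by
    have h1 := log_le_add_div_sub_one (c := 250000) (by norm_num) hL0
    have h2 := log_le_of_le_exp_nat (y := 250000) (by norm_num) 13 (by norm_num)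
    norm_num at h1 h2 ⊢
    linarith
  refine not_isPInteger_of_cost_le (T := ⌈10 * L⌉₊) (by linarith) (by linarith)
    (prod_one_sub_le_of_thousand_le hz1000) ?_ ?_
  · have hθ : Chebyshev.theta z ≤ 0.13863 * L := by
      refine (Chebyshev.theta_le_log4_mul_x hz0.le).trans ?_
      have : Real.log 4 ≤ 1.3863 := by
        rw [show (4 : ℝ) = 2 ^ 2 by norm_num, Real.log_pow]
        push_cast
        linarith [Real.log_two_lt_d9]
      nlinarith
    have h235 : Real.log (2.35 * L) ≤ 0.855 + Real.log L := by
      rw [Real.log_mul (by norm_num) hL0.ne']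
      have := log_le_of_pow_le (y := 2.35) (a := 55) (b := 47) (by norm_num) (by norm_num)
        (by norm_num)
      norm_num at this ⊢
      linarith
    have hlast : Real.log (2.35 * L + ⌈10 * L⌉₊ + 1) ≤ 3 + Real.log L := by
      have h1 := (Nat.ceil_lt_add_one (show 0 ≤ 10 * L by positivity)).le
      refine (Real.log_le_log (by positivity)
        (by linarith : _ ≤ 13 * L)).trans ?_
      rw [Real.log_mul (by norm_num) hL0.ne']
      have h2 := log_le_of_le_exp_nat (y := 13) (by norm_num) 3 (by norm_num)
      norm_num at h2
      linarith
    have hmain : 1.087 * L * (0.6 / Real.log z) * Real.log (2.35 * L) ≤ 0.8562 * L := by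
      have h1 : Real.log (2.35 * L) ≤ 1.3125 * Real.log z := by linarith
      have h2 : 1.087 * L * (0.6 / Real.log z) * (1.3125 * Real.log z)
          = 1.087 * 0.6 * 1.3125 * L := by
        field_simp
      refine (mul_le_mul_of_nonneg_left h1 (by positivity)).trans ?_
      rw [h2]
      norm_num
      linarith
    rw [add_mul, one_mul]
    linarith
  · refine lt_of_le_of_lt (sum_large_primeFactors_le hk0 (by omega) le_rfl (s := 0) (by simp) _) ?_
    have hT := Nat.le_ceil (10 * L)
    set T : ℝ := (⌈10 * L⌉₊ : ℝ)
    rw [← hL, zero_add]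
    have h1 : L / (z * Real.log z) ≤ 0.9878 := by
      rw [div_le_iff₀ (by positivity)]
      have h3 : L ≤ 10.001 * z := by
        rw [div_le_iff₀ (by norm_num)] at hzge
        linarith
      nlinarith
    have h2 : L / Real.log z ≤ 0.1 * L := by
      rw [div_le_iff₀ hlz0]
      nlinarith
    have h4 : T * (L / (z * Real.log z)) ≤ T * 0.9878 :=
      mul_le_mul_of_nonneg_left h1 (by linarith)
    linarith

/-- If `k` is a P-integer, then `k < 10 ^ 3500`. -/
theorem pomerance_upper_bound (k : ℕ) (hk : IsPInteger k) : k < 10 ^ 3500 := by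
  by_contra! h
  have h1 : 3500 * Real.log 10 ≤ Real.log k := by
    have h2 : ((10 ^ 3500 : ℕ) : ℝ) ≤ k := Nat.cast_le.2 h
    rw [Nat.cast_pow] at h2
    have h3 := Real.log_le_log (by positivity) h2
    rwa [Real.log_pow] at h3
  have h8059 : 8059 ≤ Real.log k := log_ten_ge.trans h1
  rcases le_total (Real.log k) 20000 with h20 | h20
  · exact not_isPInteger_of_log_le_20000 h8059 h20 hk
  rcases le_total (Real.log k) 100000 with h100 | h100
  · exact not_isPInteger_of_log_le_100000 h20 h100 hk
  rcases le_total (Real.log k) 250000 with h250 | h250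
  · exact not_isPInteger_of_log_le_250000 h100 h250 hk
  · exact not_isPInteger_of_le_log h250 hk
end

section
/- Let k > 30 be an integer, set T = φ(k) + ω(k), let t = ⌊p_T / k⌋, and define L = t − 1 if the residue of p_T modulo k is less than k/2 and L = t otherwise. If the sum over n from 0 to L of (2·π(nk + k/2) − π(nk) − π(nk + k)) exceeds log k, then k is not a P-integer. -/
open scoped BigOperators

/-- The weight of `m` modulo `k`: `1` if the residue lies in `(0, k / 2]`, and `-1` otherwise. -/
def halfSign (k m : ℕ) : ℤ := if 0 < m % k ∧ 2 * (m % k) ≤ k then 1 else -1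

lemma halfSign_mod (k m : ℕ) : halfSign k (m % k) = halfSign k m := by
  simp [halfSign]

lemma halfSign_le_one (k m : ℕ) : halfSign k m ≤ 1 := by
  unfold halfSign
  split_ifs <;> norm_num

lemma halfSign_sub {k r : ℕ} (hk : 2 < k) (hr : r < k) (hc : r.Coprime k) :
    halfSign k (k - r) = -halfSign k r := by
  have h0 : 0 < r := by
    rcases Nat.eq_zero_or_pos r with rfl | h
    · simp at hc
      omega
    · exact h
  have h2 : 2 * r ≠ k := by
    rintro rfl
    have : r = 1 := Nat.Coprime.eq_one_of_dvd hc ⟨2, mul_comm 2 r⟩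
    omega
  unfold halfSign
  rw [Nat.mod_eq_of_lt hr, Nat.mod_eq_of_lt (show k - r < k by omega)]
  split_ifs <;> omega

lemma sum_halfSign_coprime {k : ℕ} (hk : 2 < k) :
    ∑ r ∈ (Finset.range k).filter (fun r => r.Coprime k), halfSign k r = 0 := by
  have hpos : ∀ r, r.Coprime k → 0 < r := by
    intro r hc
    rcases Nat.eq_zero_or_pos r with rfl | h
    · simp at hc
      omega
    · exact h
  have h : ∑ r ∈ (Finset.range k).filter (fun r => r.Coprime k), halfSign k r =
      ∑ r ∈ (Finset.range k).filter (fun r => r.Coprime k), -halfSign k r := by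
    have hmem : ∀ r ∈ (Finset.range k).filter (fun r => r.Coprime k),
        k - r ∈ (Finset.range k).filter (fun r => r.Coprime k) := by
      intro r hr
      simp only [Finset.mem_filter, Finset.mem_range] at hr ⊢
      have := hpos r hr.2
      refine ⟨by omega, ?_⟩
      rw [Nat.coprime_self_sub_left hr.1.le]
      exact hr.2
    refine Finset.sum_nbij' (fun r => k - r) (fun r => k - r) hmem hmem ?_ ?_ ?_
    · intro r hr
      simp only [Finset.mem_filter, Finset.mem_range] at hr
      omega
    · intro r hr
      simp only [Finset.mem_filter, Finset.mem_range] at hr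
      omega
    · intro r hr
      simp only [Finset.mem_filter, Finset.mem_range] at hr
      rw [halfSign_sub hk hr.1 hr.2, neg_neg]
  rw [Finset.sum_neg_distrib] at h
  omega

lemma image_nth_range_count (p : ℕ → Prop) [DecidablePred p] (hp : {x | p x}.Infinite) (m : ℕ) :
    (Finset.range (Nat.count p m)).image (Nat.nth p) = (Finset.range m).filter p := by
  ext x
  simp only [Finset.mem_image, Finset.mem_range, Finset.mem_filter]
  constructor
  · rintro ⟨i, hi, rfl⟩
    exact ⟨Nat.nth_lt_of_lt_count hi, Nat.nth_mem_of_infinite hp i⟩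
  · rintro ⟨hx, hpx⟩
    exact ⟨Nat.count p x, Nat.count_strict_mono hpx hx, Nat.nth_count hpx⟩

lemma infinite_prime_not_dvd {k : ℕ} (hk : k ≠ 0) :
    {p : ℕ | p.Prime ∧ ¬ p ∣ k}.Infinite := by
  have h := Nat.infinite_setOfPred_prime.sdiff (Nat.divisors k).finite_toSet
  refine h.mono ?_
  rintro p ⟨hp, hd⟩
  refine ⟨hp, fun hpk => hd ?_⟩
  simp [hpk, hk]

/-- For a `P`-integer, its first `φ(k)` coprime primes are balanced around `k / 2`. -/
lemma IsPInteger.sum_halfSign {k : ℕ} (hk : 2 < k) (h : IsPInteger k) :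
    ∑ i ∈ Finset.range k.totient, halfSign k (nthPrimeNotDvd k i) = 0 := by
  obtain ⟨-, hinj, himg⟩ := h
  rw [← sum_halfSign_coprime hk]
  have him : (Finset.range k.totient).image (fun i => nthPrimeNotDvd k i % k) =
      (Finset.range k).filter (fun r => r.Coprime k) := by
    apply Finset.coe_injective
    rw [Finset.coe_image, Finset.coe_range, himg]
    ext r
    simp
  rw [← him, Finset.sum_image]
  · exact Finset.sum_congr rfl fun i _ => (halfSign_mod _ _).symm
  · rw [Finset.coe_range]
    exact hinj

lemma count_prime_succ_lt {k : ℕ} (hk : 1 < k) :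
    Nat.count Nat.Prime (k + 1) < k.totient + k.primeFactors.card := by
  rw [Nat.count_eq_card_filter_range]
  have hsub : (Finset.range (k + 1)).filter Nat.Prime ⊆
      k.primeFactors ∪ ((Finset.range k).filter (fun r => k.Coprime r)).erase 1 := by
    intro p hp
    simp only [Finset.mem_filter, Finset.mem_range, Finset.mem_union, Finset.mem_erase,
      Nat.mem_primeFactors] at hp ⊢
    by_cases hd : p ∣ k
    · exact Or.inl ⟨hp.2, hd, by omega⟩
    · refine Or.inr ⟨hp.2.one_lt.ne', ?_, ((Nat.Prime.coprime_iff_not_dvd hp.2).2 hd).symm⟩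
      rcases eq_or_ne p k with rfl | hne
      · exact absurd dvd_rfl hd
      · omega
  have h1 : 1 ∈ (Finset.range k).filter (fun r => k.Coprime r) := by simp [hk]
  have h2 := (Finset.card_le_card hsub).trans (Finset.card_union_le _ _)
  have h3 := Finset.card_erase_lt_of_mem h1
  rw [Nat.totient_eq_card_coprime]
  exact h2.trans_lt (by omega)

lemma count_prime_not_dvd {k m : ℕ} (hk : k ≠ 0) (hm : k < m) :
    Nat.count (fun p => p.Prime ∧ ¬ p ∣ k) m + k.primeFactors.card = Nat.count Nat.Prime m := by
  rw [Nat.count_eq_card_filter_range, Nat.count_eq_card_filter_range,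
    ← Finset.card_union_of_disjoint]
  · congr 1
    ext p
    simp only [Finset.mem_filter, Finset.mem_range, Finset.mem_union, Nat.mem_primeFactors]
    have : p ∣ k → p < m := fun h => (Nat.le_of_dvd (by omega) h).trans_lt hm
    tauto
  · rw [Finset.disjoint_left]
    intro p hp hp'
    simp only [Finset.mem_filter, Nat.mem_primeFactors] at hp hp'
    exact hp.2.2 hp'.2.1

lemma primePi_natCast_add_half (a k : ℕ) :
    primePi ((a : ℕ) + (k : ℝ) / 2) = Nat.count Nat.Prime (a + k / 2 + 1) := by
  have h : ⌊((a : ℕ) : ℝ) + (k : ℝ) / 2⌋₊ = a + k / 2 := by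
    rw [add_comm, Nat.floor_add_natCast (by positivity), add_comm]
    congr 1
    exact_mod_cast Nat.floor_div_eq_div (K := ℝ) k 2
  rw [primePi, h, Nat.count_eq_card_filter_range]

lemma primePi_natCast (a : ℕ) : primePi (a : ℝ) = Nat.count Nat.Prime (a + 1) := by
  rw [primePi, Nat.floor_natCast, Nat.count_eq_card_filter_range]

lemma sum_filter_range_add (p : ℕ → Prop) [DecidablePred p] (f : ℕ → ℤ) (c : ℤ) (a d : ℕ)
    (h : ∀ i < d, f (a + i) = c) :
    ∑ m ∈ (Finset.range (a + d)).filter p, f m =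
      ∑ m ∈ (Finset.range a).filter p, f m + c * (Nat.count p (a + d) - Nat.count p a) := by
  induction d with
  | zero => simp
  | succ d ih =>
    rw [← add_assoc, Finset.range_add_one, Finset.filter_insert, Nat.count_succ]
    have ih' := ih fun i hi => h i (by omega)
    split_ifs with hp
    · rw [Finset.sum_insert (by simp), ih', h d (by omega)]
      push_cast
      ring
    · rw [ih']
      simp

lemma halfSign_sum_succ {k : ℕ} (hk : 0 < k) (n : ℕ) :
    ∑ m ∈ (Finset.range ((n + 1) * k + 1)).filter Nat.Prime, halfSign k m =
      ∑ m ∈ (Finset.range (n * k + 1)).filter Nat.Prime, halfSign k m +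
        (2 * (Nat.count Nat.Prime (n * k + k / 2 + 1) : ℤ) - Nat.count Nat.Prime (n * k + 1) -
          Nat.count Nat.Prime (n * k + k + 1)) := by
  have e1 : (n + 1) * k + 1 = (n * k + 1 + k / 2) + (k - k / 2) := by
    rw [add_mul]
    omega
  have e2 : n * k + k / 2 + 1 = n * k + 1 + k / 2 := by ring
  have e3 : n * k + k + 1 = (n * k + 1 + k / 2) + (k - k / 2) := by omega
  rw [e1, sum_filter_range_add _ _ (-1), sum_filter_range_add _ _ 1, e2, e3]
  · ring
  · intro i hi
    have : (n * k + 1 + i) % k = (1 + i) % k := by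
      rw [add_assoc, add_comm, Nat.add_mul_mod_self_right]
    unfold halfSign
    rw [this]
    rcases Nat.lt_or_ge (1 + i) k with h | h
    · rw [Nat.mod_eq_of_lt h, if_pos (by omega)]
    · omega
  · intro i hi
    have : (n * k + 1 + k / 2 + i) % k = (1 + k / 2 + i) % k := by
      rw [add_assoc, add_assoc, add_comm, Nat.add_mul_mod_self_right, add_assoc]
    unfold halfSign
    rw [this]
    rcases Nat.lt_or_ge (1 + k / 2 + i) k with h | h
    · rw [Nat.mod_eq_of_lt h, if_neg (by omega)]
    · have : 1 + k / 2 + i = k := by omega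
      simp [this]

lemma sum_primePi_eq {k : ℕ} (hk : 0 < k) (N : ℕ) :
    ∑ n ∈ Finset.range N,
        (2 * (primePi ((n * k : ℕ) + (k : ℝ) / 2) : ℝ) -
          primePi ((n * k : ℕ) : ℝ) - primePi ((n * k + k : ℕ) : ℝ)) =
      ((∑ m ∈ (Finset.range (N * k + 1)).filter Nat.Prime, halfSign k m : ℤ) : ℝ) := by
  induction N with
  | zero => simp [Finset.filter_singleton, Nat.not_prime_zero]
  | succ N ih =>
    rw [Finset.sum_range_succ, ih, halfSign_sum_succ hk, primePi_natCast_add_half,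
      primePi_natCast, primePi_natCast]
    push_cast
    ring

lemma card_primeFactors_le_log {k : ℕ} (hk : 30 < k) :
    (k.primeFactors.card : ℝ) ≤ Real.log k := by
  rcases Nat.lt_or_ge 3 k.primeFactors.card with h | h
  · have hlog : ∑ p ∈ k.primeFactors, Real.log p ≤ Real.log k := by
      rw [← Real.log_prod]
      · apply Real.log_le_log
        · exact Finset.prod_pos fun p hp => by
            exact_mod_cast (Nat.prime_of_mem_primeFactors hp).pos
        · have := Nat.le_of_dvd (by omega) (Nat.prod_primeFactors_dvd k)
          rw [← Nat.cast_prod]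
          exact_mod_cast this
      · intro p hp
        exact_mod_cast (Nat.prime_of_mem_primeFactors hp).ne_zero
    obtain ⟨q, hq, hq5⟩ : ∃ q ∈ k.primeFactors, 5 ≤ q := by
      by_contra! hc
      have hs : k.primeFactors ⊆ {2, 3, 4} := by
        intro p hp
        have := hc p hp
        have := (Nat.prime_of_mem_primeFactors hp).two_le
        simp only [Finset.mem_insert, Finset.mem_singleton]
        omega
      have := Finset.card_le_card hs
      simp at this
      omega
    have h2 := Real.log_two_gt_d9
    have hqlog : 1 + 1 / 3 ≤ Real.log q := by
      have h4 : Real.log 4 = 2 * Real.log 2 := by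
        rw [show (4 : ℝ) = 2 ^ 2 by norm_num, Real.log_pow]
        norm_num
      have : Real.log 4 ≤ Real.log q :=
        Real.log_le_log (by norm_num) (by exact_mod_cast (by omega : 4 ≤ q))
      linarith
    have hterm : ∀ p ∈ k.primeFactors,
        1 + ((if p = q then 1 / 3 else 0) + if p = 2 then -1 / 3 else 0) ≤ Real.log p := by
      intro p hp
      have hp2 := (Nat.prime_of_mem_primeFactors hp).two_le
      by_cases hpq : p = q
      · subst hpq
        rw [if_pos rfl, if_neg (by omega)]
        linarith
      · rw [if_neg hpq]
        split_ifs with hp'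
        · subst hp'
          push_cast
          linarith
        · have h3 : (3 : ℝ) ≤ p := by exact_mod_cast (by omega : 3 ≤ p)
          have : Real.exp 1 ≤ p := Real.exp_one_lt_three.le.trans h3
          have := (Real.le_log_iff_exp_le (by linarith)).2 this
          linarith
    have hsum := Finset.sum_le_sum hterm
    rw [Finset.sum_add_distrib, Finset.sum_add_distrib, Finset.sum_ite_eq', if_pos hq,
      Finset.sum_ite_eq'] at hsum
    have h0 : (-1 / 3 : ℝ) ≤ if 2 ∈ k.primeFactors then -1 / 3 else 0 := by
      split_ifs <;> norm_num
    simp only [Finset.sum_const, nsmul_eq_mul, mul_one] at hsum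
    linarith
  · have hc : (k.primeFactors.card : ℝ) ≤ 3 := by exact_mod_cast h
    refine hc.trans ?_
    have hk' : (27 : ℝ) ≤ k := by exact_mod_cast (by omega : 27 ≤ k)
    rw [Real.le_log_iff_exp_le (by linarith)]
    have he : Real.exp 3 = Real.exp 1 ^ 3 := by
      rw [← Real.exp_nat_mul]
      norm_num
    rw [he]
    calc Real.exp 1 ^ 3 ≤ (3 : ℝ) ^ 3 := by
          gcongr
          exact Real.exp_one_lt_three.le
      _ ≤ (k : ℝ) := by linarith

lemma sum_halfSign_prime_le {k : ℕ} (hk : k ≠ 0) (m : ℕ) :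
    ∑ p ∈ (Finset.range m).filter Nat.Prime, halfSign k p ≤
      k.primeFactors.card +
        ∑ p ∈ (Finset.range m).filter (fun p => p.Prime ∧ ¬ p ∣ k), halfSign k p := by
  rw [← Finset.sum_filter_add_sum_filter_not _ (fun p => p ∣ k), Finset.filter_filter,
    Finset.filter_filter]
  gcongr
  calc ∑ p ∈ (Finset.range m).filter (fun p => p.Prime ∧ p ∣ k), halfSign k p
      ≤ ∑ p ∈ (Finset.range m).filter (fun p => p.Prime ∧ p ∣ k), (1 : ℤ) :=
        Finset.sum_le_sum fun p _ => halfSign_le_one k p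
    _ = ((Finset.range m).filter (fun p => p.Prime ∧ p ∣ k)).card := by simp
    _ ≤ k.primeFactors.card := by
        norm_cast
        apply Finset.card_le_card
        intro p hp
        simp only [Finset.mem_filter, Nat.mem_primeFactors] at hp ⊢
        exact ⟨hp.2.1, hp.2.2, hk⟩

lemma sum_filter_range_le_of_nonneg {p : ℕ → Prop} [DecidablePred p] {f : ℕ → ℤ} {a b : ℕ}
    (hab : a ≤ b) (h : ∀ m, a ≤ m → m < b → p m → 0 ≤ f m) :
    ∑ m ∈ (Finset.range a).filter p, f m ≤ ∑ m ∈ (Finset.range b).filter p, f m := by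
  apply Finset.sum_le_sum_of_subset_of_nonneg
  · exact Finset.filter_subset_filter _ (Finset.range_mono hab)
  · intro m hm hm'
    simp only [Finset.mem_filter, Finset.mem_range] at hm hm'
    exact h m (by by_contra hc; exact hm' ⟨by omega, hm.2⟩) hm.1 hm.2

lemma sum_halfSign_blocks_le {k : ℕ} (hk : 1 < k) {q : ℕ} (hq : k ≤ q) :
    ∑ p ∈ (Finset.range (((if 2 * (q % k) < k then q / k - 1 else q / k) + 1) * k + 1)).filter
        (fun p => p.Prime ∧ ¬ p ∣ k), halfSign k p ≤
      ∑ p ∈ (Finset.range (q + 1)).filter (fun p => p.Prime ∧ ¬ p ∣ k), halfSign k p := by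
  have hdm := Nat.div_add_mod q k
  have hlt := Nat.mod_lt q (by omega : 0 < k)
  have ht : 0 < q / k := Nat.div_pos hq (by omega)
  set t := q / k
  set r := q % k
  split_ifs with hr
  · rw [Nat.sub_add_cancel ht, mul_comm]
    refine sum_filter_range_le_of_nonneg (by omega) fun m hm hm' hp => ?_
    obtain ⟨i, rfl⟩ := Nat.exists_eq_add_of_le (by omega : k * t ≤ m)
    have hmod : (k * t + i) % k = i := by
      rw [Nat.mul_add_mod, Nat.mod_eq_of_lt (by omega)]
    unfold halfSign
    rw [hmod, if_pos (by omega)]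
    norm_num
  · have hN : (t + 1) * k = k * t + k := by ring
    rw [hN]
    have := sum_filter_range_le_of_nonneg (p := fun p => p.Prime ∧ ¬ p ∣ k)
      (f := fun m => -halfSign k m) (a := q + 1) (b := k * t + k + 1) (by omega) ?_
    · simp only [Finset.sum_neg_distrib] at this
      omega
    · intro m hm hm' hp
      obtain ⟨i, rfl⟩ := Nat.exists_eq_add_of_le (by omega : k * t ≤ m)
      unfold halfSign
      rw [Nat.mul_add_mod]
      rcases Nat.lt_or_ge i k with h | h
      · rw [Nat.mod_eq_of_lt h, if_neg (by omega)]
        norm_num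
      · have : i = k := by omega
        simp [this]

theorem not_PInteger_of_sum_gt_log (k : ℕ) (hk : 30 < k) (T t L : ℕ)
    (hT : T = k.totient + k.primeFactors.card)
    (ht : t = nthPrime T / k)
    (hL : L = if 2 * (nthPrime T % k) < k then t - 1 else t)
    (hS : Real.log k <
      ∑ n ∈ Finset.range (L + 1),
        (2 * (primePi ((n * k : ℕ) + (k : ℝ) / 2) : ℝ) -
          primePi ((n * k : ℕ) : ℝ) - primePi ((n * k + k : ℕ) : ℝ))) :
    ¬ IsPInteger k := by
  intro hP
  have htot : 0 < k.totient := Nat.totient_pos.2 (by omega)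
  have hinf := infinite_prime_not_dvd (show k ≠ 0 by omega)
  have hq : k + 1 ≤ nthPrime T := by
    have := count_prime_succ_lt (show 1 < k by omega)
    exact (Nat.count_le_iff_le_nth Nat.infinite_setOfPred_prime).1
      (show Nat.count Nat.Prime (k + 1) ≤ T - 1 by omega)
  have hcount : Nat.count Nat.Prime (nthPrime T + 1) = T := by
    rw [nthPrime, Nat.count_nth_succ_of_infinite Nat.infinite_setOfPred_prime]
    omega
  have hcount' : Nat.count (fun p => p.Prime ∧ ¬ p ∣ k) (nthPrime T + 1) = k.totient := by
    have := count_prime_not_dvd (show k ≠ 0 by omega) (show k < nthPrime T + 1 by omega)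
    omega
  have hzero : ∑ p ∈ (Finset.range (nthPrime T + 1)).filter (fun p => p.Prime ∧ ¬ p ∣ k),
      halfSign k p = 0 := by
    rw [← image_nth_range_count _ hinf, hcount',
      Finset.sum_image (Nat.nth_injective hinf).injOn]
    exact hP.sum_halfSign (by omega)
  have hblocks := sum_halfSign_blocks_le (show 1 < k by omega) (show k ≤ nthPrime T by omega)
  rw [← ht, ← hL, hzero] at hblocks
  have hle := sum_halfSign_prime_le (show k ≠ 0 by omega) ((L + 1) * k + 1)
  rw [sum_primePi_eq (by omega)] at hS
  have hle' : ((∑ p ∈ (Finset.range ((L + 1) * k + 1)).filter Nat.Prime, halfSign k p : ℤ) : ℝ) ≤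
      k.primeFactors.card := by
    exact_mod_cast (by omega : (_ : ℤ) ≤ k.primeFactors.card)
  linarith [card_primeFactors_le_log hk]
end
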